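/- arXiv:2304.04095 — 5 statements merged into one kernel-verified Lean document; each statement's English description precedes it below -/
import Mathlib

section
/- Let f : ℝ^d → ℝ be continuously differentiable, η > 0, and (q₀, p₀) ∈ ℝ^d × ℝ^d. With q_t := q₀ + t·p₀ − (t²/2)∇f(q₀), q_η and p_η := p₀ − (η/2)∇f(q₀) − (η/2)∇f(q_η), the energy difference Δ_η(q₀,p₀) := f(q_η) − f(q₀) + ½‖p_η‖² − ½‖p₀‖² satisfies the exact identity Δ_η(q₀,p₀) = B_η(q₀,p₀) + (η²/8)·‖∇f(q_η) − ∇f(q₀)‖², where B_η(q₀,p₀) := ∇f(q₀)ᵀ[−∫₀^η t(∇f(q_t) − ∇f(q_η)) dt] + p₀ᵀ ∫₀^η (∇f(q_t) − ½∇f(q₀) − ½∇f(q_η)) dt. -/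
open MeasureTheory Real Filter
open scoped ENNReal RealInnerProductSpace

noncomputable section

/-- `ℝ^d` with the Euclidean structure. -/
abbrev Ed (d : ℕ) := EuclideanSpace ℝ (Fin d)

variable {d : ℕ}

/-- The Hessian `∇²f(x)` of `f` at `x`, as a continuous linear map. -/
def hess (f : Ed d → ℝ) (x : Ed d) : Ed d →L[ℝ] Ed d := fderiv ℝ (gradient f) x

/-- The trace of the Hessian of `f` at `x`. -/
def hessTrace (f : Ed d → ℝ) (x : Ed d) : ℝ :=
  LinearMap.trace ℝ (Ed d) (hess f x : Ed d →ₗ[ℝ] Ed d)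

/-- `f` is `L`-smooth: `∇²f(x) ⪯ L·I` for every `x`. -/
def LSmooth (f : Ed d → ℝ) (L : ℝ) : Prop :=
  ∀ x v : Ed d, ⟪v, hess f x v⟫ ≤ L * ‖v‖ ^ 2

/-- `μ ∝ e^{-f}`: `μ` is a probability measure proportional to `e^{-f}·Lebesgue`. -/
def IsGibbs (f : Ed d → ℝ) (μ : Measure (Ed d)) : Prop :=
  IsProbabilityMeasure μ ∧ ∃ Z : ℝ, 0 < Z ∧
    ∀ s : Set (Ed d), MeasurableSet s →
      μ s = ENNReal.ofReal Z⁻¹ * ∫⁻ x in s, ENNReal.ofReal (Real.exp (-f x))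

/-- `e^{-f}` is subexponential-tailed. -/
def SubexpTailed (f : Ed d → ℝ) : Prop :=
  ∃ lam : ℝ, 0 < lam ∧
    Tendsto (fun x : Ed d => Real.exp (-lam * ‖x‖) * Real.exp (-f x)) (cocompact (Ed d)) (nhds 0)

/-- The standard Gaussian `N(0, I_d)` on `ℝ^d`. -/
def stdGaussian (d : ℕ) : Measure (Ed d) :=
  volume.withDensity fun p => ENNReal.ofReal ((2 * π) ^ (-(d : ℝ) / 2) * Real.exp (-‖p‖ ^ 2 / 2))

/-- The Gaussian `N(m, s·I_d)` on `ℝ^d` (each coordinate has variance `s`). -/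
def gaussMeasure (m : Ed d) (s : ℝ) : Measure (Ed d) :=
  volume.withDensity fun x =>
    ENNReal.ofReal ((2 * π * s) ^ (-(d : ℝ) / 2) * Real.exp (-‖x - m‖ ^ 2 / (2 * s)))

/-- Total variation distance between two measures. -/
def tvDist {α : Type*} [MeasurableSpace α] (P Q : Measure α) : ℝ :=
  ⨆ s : {s : Set α // MeasurableSet s}, |(P s.1).toReal - (Q s.1).toReal|

/-- Leapfrog position `q_t = q₀ + t·p₀ − (t²/2)∇f(q₀)`. -/
def leapQ (f : Ed d → ℝ) (t : ℝ) (q₀ p₀ : Ed d) : Ed d :=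
  q₀ + t • p₀ - (t ^ 2 / 2) • gradient f q₀

/-- Leapfrog momentum `p_η = p₀ − (η/2)∇f(q₀) − (η/2)∇f(q_η)`. -/
def leapP (f : Ed d → ℝ) (η : ℝ) (q₀ p₀ : Ed d) : Ed d :=
  p₀ - (η / 2) • gradient f q₀ - (η / 2) • gradient f (leapQ f η q₀ p₀)

/-- The MALA (Metropolis–Hastings) acceptance probability. -/
def accept (f : Ed d → ℝ) (η : ℝ) (q₀ p₀ : Ed d) : ℝ :=
  min 1 (Real.exp (-f (leapQ f η q₀ p₀) - ‖leapP f η q₀ p₀‖ ^ 2 / 2) /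
    Real.exp (-f q₀ - ‖p₀‖ ^ 2 / 2))

/-- One step of MALA (step-size `h = η²/2`) started at `q₀`. -/
def malaKernel (f : Ed d → ℝ) (η : ℝ) (q₀ : Ed d) : Measure (Ed d) :=
  ((stdGaussian d).withDensity fun p₀ => ENNReal.ofReal (accept f η q₀ p₀)).map
      (fun p₀ => leapQ f η q₀ p₀)
    + (ENNReal.ofReal (1 - ∫ p₀, accept f η q₀ p₀ ∂(stdGaussian d))) • Measure.dirac q₀

/-- The lazy variant of MALA. -/
def lazyMala (f : Ed d → ℝ) (η : ℝ) (q₀ : Ed d) : Measure (Ed d) :=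
  (2⁻¹ : ℝ≥0∞) • Measure.dirac q₀ + (2⁻¹ : ℝ≥0∞) • malaKernel f η q₀

/-- The transition operator of a Markov kernel. -/
def transOp {α : Type*} [MeasurableSpace α] (P : α → Measure α) (ν : Measure α) : Measure α :=
  ν.bind P

/-- `μ₀` is an `M`-warm start with respect to `μ`. -/
def Warm {α : Type*} [MeasurableSpace α] (μ₀ μ : Measure α) (M : ℝ) : Prop :=
  ∀ s : Set α, MeasurableSet s → μ₀ s ≤ ENNReal.ofReal M * μ s

/-- The `ε`-mixing time of the chain `P` from `μ₀` to `μ`. -/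
def mixTime {α : Type*} [MeasurableSpace α] (P : α → Measure α) (μ₀ μ : Measure α) (ε : ℝ) : ℕ :=
  sInf {n : ℕ | tvDist ((transOp P)^[n] μ₀) μ ≤ ε}

/-- The distance `inf{‖x − y‖ : x ∈ S₁, y ∈ S₂}` between two sets. -/
def setDist (S₁ S₂ : Set (Ed d)) : ℝ := ⨅ x : S₁, ⨅ y : S₂, dist x.1 y.1

/-- Cheeger's isoperimetric inequality with coefficient `ψ`. -/
def CheegerIso (μ : Measure (Ed d)) (ψ : ℝ) : Prop :=
  ∀ S₁ S₂ S₃ : Set (Ed d), MeasurableSet S₁ → MeasurableSet S₂ → MeasurableSet S₃ →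
    S₁ ∪ S₂ ∪ S₃ = Set.univ → Disjoint S₁ S₂ → Disjoint S₁ S₃ → Disjoint S₂ S₃ →
    (μ S₃).toReal ≥ ψ * setDist S₁ S₂ * (μ S₁).toReal * (μ S₂).toReal

/-- The `s`-conductance of the chain `P` with stationary measure `μ`. -/
def sConductance {α : Type*} [MeasurableSpace α] (P : α → Measure α) (μ : Measure α) (s : ℝ) :
    ℝ :=
  sInf {r : ℝ | ∃ S : Set α, MeasurableSet S ∧ s < (μ S).toReal ∧ (μ S).toReal < 1 - s ∧
    r = (∫⁻ x in S, P x Sᶜ ∂μ).toReal / (min (μ S).toReal (μ Sᶜ).toReal - s)}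

/-- The vector `v_η(q₀,p₀) ∈ ℝ^{2d}` from the integration-by-parts argument. -/
def vEta (f : Ed d → ℝ) (η : ℝ) (z : Ed d × Ed d) : Ed d × Ed d :=
  (-(∫ t in (0:ℝ)..η, t • (gradient f (leapQ f t z.1 z.2) - gradient f (leapQ f η z.1 z.2))),
   ∫ t in (0:ℝ)..η, (gradient f (leapQ f t z.1 z.2) - (2⁻¹ : ℝ) • gradient f z.1
       - (2⁻¹ : ℝ) • gradient f (leapQ f η z.1 z.2)))

/-- exact decomposition of the energy difference. -/
theorem energy_difference_identity {d : ℕ} (f : Ed d → ℝ) (η : ℝ)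
    (hf : ContDiff ℝ 1 f) (hη : 0 < η) (q₀ p₀ : Ed d) :
    f (leapQ f η q₀ p₀) - f q₀ + ‖leapP f η q₀ p₀‖ ^ 2 / 2 - ‖p₀‖ ^ 2 / 2 =
      ((⟪gradient f q₀,
          -(∫ t in (0:ℝ)..η,
            t • (gradient f (leapQ f t q₀ p₀) - gradient f (leapQ f η q₀ p₀)))⟫ : ℝ)
        + (⟪p₀, ∫ t in (0:ℝ)..η,
            (gradient f (leapQ f t q₀ p₀) - (2⁻¹ : ℝ) • gradient f q₀
              - (2⁻¹ : ℝ) • gradient f (leapQ f η q₀ p₀))⟫ : ℝ))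
      + η ^ 2 / 8 * ‖gradient f (leapQ f η q₀ p₀) - gradient f q₀‖ ^ 2 := by
  have hgc : Continuous (gradient f) := by
    unfold gradient
    exact (InnerProductSpace.toDual ℝ (Ed d)).symm.continuous.comp (hf.continuous_fderiv one_ne_zero)
  have hqc : Continuous (fun t : ℝ => leapQ f t q₀ p₀) := by
    unfold leapQ; fun_prop
  have hGc : Continuous (fun t : ℝ => gradient f (leapQ f t q₀ p₀)) := hgc.comp hqc
  have hq : ∀ t : ℝ, HasDerivAt (fun t : ℝ => leapQ f t q₀ p₀) (p₀ - t • gradient f q₀) t := by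
    intro t
    unfold leapQ
    have h1 : HasDerivAt (fun t : ℝ => q₀ + t • p₀) ((1 : ℝ) • p₀) t :=
      ((hasDerivAt_id t).smul_const p₀).const_add q₀
    have h2 : HasDerivAt (fun t : ℝ => t ^ 2 / 2) t t := by
      have := (hasDerivAt_pow 2 t).div_const 2
      have e : ((2 : ℕ) : ℝ) * t ^ (2 - 1) / 2 = t := by
        norm_num
      rw [e] at this
      exact this
    have h3 := h1.sub (h2.smul_const (gradient f q₀))
    rw [one_smul] at h3
    exact h3
  have hfd : ∀ t : ℝ, HasDerivAt (fun t : ℝ => f (leapQ f t q₀ p₀))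
      (⟪gradient f (leapQ f t q₀ p₀), p₀ - t • gradient f q₀⟫ : ℝ) t := by
    intro t
    have hd := ((hf.differentiable one_ne_zero) (leapQ f t q₀ p₀)).hasGradientAt.hasFDerivAt
    have := hd.comp_hasDerivAt t (hq t)
    exact this
  have hI : ∫ t in (0:ℝ)..η, (⟪gradient f (leapQ f t q₀ p₀), p₀ - t • gradient f q₀⟫ : ℝ)
      = f (leapQ f η q₀ p₀) - f q₀ := by
    rw [intervalIntegral.integral_eq_sub_of_hasDerivAt (fun t _ => hfd t)
      (Continuous.intervalIntegrable (by fun_prop) _ _)]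
    simp [leapQ]
  have hin : ∀ (v : Ed d) (F : ℝ → Ed d), Continuous F →
      (⟪v, ∫ t in (0:ℝ)..η, F t⟫ : ℝ) = ∫ t in (0:ℝ)..η, (⟪v, F t⟫ : ℝ) := by
    intro v F hF
    exact ((innerSL ℝ v).intervalIntegral_comp_comm (hF.intervalIntegrable _ _)).symm
  rw [inner_neg_right, hin _ _ (by fun_prop), hin _ _ (by fun_prop), ← hI]
  have hK : ‖leapP f η q₀ p₀‖ ^ 2 / 2 - ‖p₀‖ ^ 2 / 2
      - η ^ 2 / 8 * ‖gradient f (leapQ f η q₀ p₀) - gradient f q₀‖ ^ 2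
      = η ^ 2 / 2 * (⟪gradient f q₀, gradient f (leapQ f η q₀ p₀)⟫ : ℝ)
        - η / 2 * ((⟪p₀, gradient f q₀⟫ : ℝ) + ⟪p₀, gradient f (leapQ f η q₀ p₀)⟫) := by
    unfold leapP
    generalize gradient f (leapQ f η q₀ p₀) = b
    generalize gradient f q₀ = a
    simp only [← real_inner_self_eq_norm_sq, inner_sub_left, inner_sub_right,
      real_inner_smul_left, real_inner_smul_right]
    rw [real_inner_comm p₀ a, real_inner_comm p₀ b, real_inner_comm a b]
    ring
  have hC : ∫ t in (0:ℝ)..η, (t * (⟪gradient f q₀, gradient f (leapQ f η q₀ p₀)⟫ : ℝ)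
        - 1 / 2 * ((⟪p₀, gradient f q₀⟫ : ℝ) + ⟪p₀, gradient f (leapQ f η q₀ p₀)⟫))
      = η ^ 2 / 2 * (⟪gradient f q₀, gradient f (leapQ f η q₀ p₀)⟫ : ℝ)
        - η / 2 * ((⟪p₀, gradient f q₀⟫ : ℝ) + ⟪p₀, gradient f (leapQ f η q₀ p₀)⟫) := by
    rw [intervalIntegral.integral_sub (Continuous.intervalIntegrable (by fun_prop) _ _)
      (Continuous.intervalIntegrable (by fun_prop) _ _), intervalIntegral.integral_mul_const,
      integral_id, intervalIntegral.integral_const]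
    simp only [smul_eq_mul]
    ring
  rw [← intervalIntegral.integral_neg, ← intervalIntegral.integral_add
    (Continuous.intervalIntegrable (by fun_prop) _ _)
    (Continuous.intervalIntegrable (by fun_prop) _ _)]
  have hS : ∫ t in (0:ℝ)..η, (-(⟪gradient f q₀,
            t • (gradient f (leapQ f t q₀ p₀) - gradient f (leapQ f η q₀ p₀))⟫ : ℝ)
        + (⟪p₀, gradient f (leapQ f t q₀ p₀) - (2⁻¹ : ℝ) • gradient f q₀
              - (2⁻¹ : ℝ) • gradient f (leapQ f η q₀ p₀)⟫ : ℝ))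
      = (∫ t in (0:ℝ)..η, (⟪gradient f (leapQ f t q₀ p₀), p₀ - t • gradient f q₀⟫ : ℝ))
        + ∫ t in (0:ℝ)..η, (t * (⟪gradient f q₀, gradient f (leapQ f η q₀ p₀)⟫ : ℝ)
        - 1 / 2 * ((⟪p₀, gradient f q₀⟫ : ℝ) + ⟪p₀, gradient f (leapQ f η q₀ p₀)⟫)) := by
    rw [← intervalIntegral.integral_add
      (Continuous.intervalIntegrable (by fun_prop) _ _)
      (Continuous.intervalIntegrable (by fun_prop) _ _)]
    congr 1
    funext t
    simp only [inner_sub_right, real_inner_smul_right]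
    rw [real_inner_comm p₀ (gradient f (leapQ f t q₀ p₀)),
      real_inner_comm (gradient f q₀) (gradient f (leapQ f t q₀ p₀))]
    ring
  rw [hS, hC]
  linarith [hK]

end
end

section
/- Let ℓ ≥ 2 be an integer and let f : ℝ^d → ℝ be twice continuously differentiable and L-smooth with μ ∝ e^{-f} subexponential-tailed, and suppose all expectations below are finite. With q_t := q₀ + t·p₀ − (t²/2)∇f(q₀), v_η(q₀,p₀) := (−∫₀^η t(∇f(q_t) − ∇f(q_η)) dt ; ∫₀^η (∇f(q_t) − ½∇f(q₀) − ½∇f(q_η)) dt) ∈ ℝ^{2d}, Dv_η its Jacobian with respect to (q₀,p₀), and B_η(q₀,p₀) := v_η(q₀,p₀)ᵀ(∇f(q₀); p₀), the following integration-by-parts identity holds: E B_η^ℓ = E[B_η^{ℓ−1}·trace(Dv_η)] + (ℓ−1)·E[B_η^{ℓ−2}·(v₁ᵀ∇²f(q₀)v₁ + ‖v₂‖²)] + (ℓ−1)·E[B_η^{ℓ−2}·(∇f(q₀); p₀)ᵀ·Dv_η·v_η], where all expectations are over (q₀,p₀) ∼ μ × N(0, I_d) and v_η = (v₁; v₂).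 -/
open MeasureTheory Real Filter
open scoped ENNReal RealInnerProductSpace

noncomputable section

variable {d : ℕ}

theorem aux_div_cpt {E : Type*} [NormedAddCommGroup E] [NormedSpace ℝ E] [FiniteDimensional ℝ E]
    [MeasurableSpace E] [BorelSpace E] (ν : Measure E) [ν.IsAddHaarMeasure]
    (W : E → E) (hW : ContDiff ℝ 1 W) (hc : HasCompactSupport W) :
    ∫ z, LinearMap.trace ℝ E (fderiv ℝ W z : E →ₗ[ℝ] E) ∂ν = 0 := by
  classical
  let b := Module.finBasis ℝ E
  have htr : ∀ z, LinearMap.trace ℝ E (fderiv ℝ W z : E →ₗ[ℝ] E)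
      = ∑ i, (b.coord i).toContinuousLinearMap (fderiv ℝ W z (b i)) := by
    intro z
    rw [LinearMap.trace_eq_matrix_trace ℝ b, Matrix.trace]
    simp [LinearMap.toMatrix_apply]
  simp_rw [htr]
  have hd : ∀ v : E, Integrable (fun z => fderiv ℝ W z v) ν := by
    intro v
    apply Continuous.integrable_of_hasCompactSupport
    · exact (hW.continuous_fderiv (by norm_num)).clm_apply continuous_const
    · exact hc.fderiv_apply ℝ v
  have hz : ∀ v : E, ∫ z, fderiv ℝ W z v ∂ν = 0 := by
    intro v
    have := integral_smul_fderiv_eq_neg_fderiv_smul_of_integrable (μ := ν) (𝕜 := ℝ)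
      (f := fun _ : E => (1:ℝ)) (g := W) (v := v) (by simp) (by simpa using hd v)
      (by simpa using hW.continuous.integrable_of_hasCompactSupport hc)
      (by simp) (fun x _ => hW.differentiable (by norm_num) x)
    simpa using this
  rw [integral_finsetSum]
  · refine Finset.sum_eq_zero fun i _ => ?_
    rw [ContinuousLinearMap.integral_comp_comm _ (hd _), hz, map_zero]
  · intro i _
    exact ContinuousLinearMap.integrable_comp _ (hd _)

theorem aux_trace_smul {E : Type*} [NormedAddCommGroup E] [NormedSpace ℝ E]
    [FiniteDimensional ℝ E] (g : E → ℝ) (W : E → E) (z : E)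
    (hg : DifferentiableAt ℝ g z) (hW : DifferentiableAt ℝ W z) :
    LinearMap.trace ℝ E (fderiv ℝ (fun z => g z • W z) z : E →ₗ[ℝ] E)
      = g z * LinearMap.trace ℝ E (fderiv ℝ W z : E →ₗ[ℝ] E) + fderiv ℝ g z (W z) := by
  rw [fderiv_fun_smul hg hW]
  have : ((g z • fderiv ℝ W z + (fderiv ℝ g z).smulRight (W z) : E →L[ℝ] E) : E →ₗ[ℝ] E)
    = g z • (fderiv ℝ W z : E →ₗ[ℝ] E)
      + (fderiv ℝ g z : E →ₗ[ℝ] ℝ).smulRight (W z) := by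
    ext; simp
  rw [this, map_add, map_smul, LinearMap.trace_smulRight]
  simp

theorem aux_cutoff (E : Type*) [NormedAddCommGroup E] [NormedSpace ℝ E] [FiniteDimensional ℝ E] :
    ∃ (χ : ℕ → E → ℝ) (M : ℝ), 0 ≤ M ∧ (∀ n, ContDiff ℝ 1 (χ n)) ∧ (∀ n, HasCompactSupport (χ n)) ∧
      (∀ n z, |χ n z| ≤ 1) ∧ (∀ z, Tendsto (fun n => χ n z) atTop (nhds 1)) ∧
      (∀ z, Tendsto (fun n => fderiv ℝ (χ n) z) atTop (nhds 0)) ∧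
      (∀ n z, ‖fderiv ℝ (χ n) z‖ * (1 + ‖z‖) ≤ M) := by
  let φ : ContDiffBump (0 : E) := ⟨1, 2, by norm_num, by norm_num⟩
  have hφ : ContDiff ℝ 1 φ := φ.contDiff
  have hcs : HasCompactSupport φ := φ.hasCompactSupport
  have hφ' := hφ.continuous_fderiv (by norm_num)
  obtain ⟨M, hM⟩ := hcs.fderiv (𝕜 := ℝ) |>.exists_bound_of_continuous hφ'
  have hM0 : 0 ≤ M := (norm_nonneg _).trans (hM 0)
  let c : ℕ → ℝ := fun n => ((n:ℝ)+1)⁻¹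
  have hc0 : ∀ n, 0 < c n := fun n => by positivity
  have hc1 : ∀ n, c n ≤ 1 := fun n => by
    apply inv_le_one_of_one_le₀; linarith [Nat.cast_nonneg (α := ℝ) n]
  have hct : Tendsto c atTop (nhds 0) := by
    simpa [c, one_div] using tendsto_one_div_add_atTop_nhds_zero_nat (𝕜 := ℝ)
  have hfd : ∀ n z, fderiv ℝ (fun z => φ (c n • z)) z = c n • fderiv ℝ φ (c n • z) := by
    intro n z
    exact fderiv_comp_smul (c n)
  have hb : ∀ n z, ‖fderiv ℝ (fun z => φ (c n • z)) z‖ ≤ c n * M := by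
    intro n z
    rw [hfd, norm_smul, Real.norm_of_nonneg (hc0 n).le]
    exact mul_le_mul_of_nonneg_left (hM _) (hc0 n).le
  refine ⟨fun n z => φ (c n • z), 3 * M, by positivity, ?_, ?_, ?_, ?_, ?_, ?_⟩
  · intro n; exact hφ.comp (contDiff_const_smul _)
  · intro n
    exact hcs.comp_smul (hc0 n).ne'
  · intro n z; rw [abs_of_nonneg φ.nonneg]; exact φ.le_one
  · intro z
    have : Tendsto (fun n => φ (c n • z)) atTop (nhds (φ ((0:ℝ) • z))) :=
      (hφ.continuous.tendsto _).comp (hct.smul_const z)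
    have h1 : φ ((0:ℝ) • z) = 1 := by
      apply φ.one_of_mem_closedBall; simp [φ]
    rwa [h1] at this
  · intro z
    apply squeeze_zero_norm (fun n => hb n z)
    simpa using hct.mul_const M
  · intro n z
    by_cases hz : ‖c n • z‖ ≤ 2
    · rw [norm_smul, Real.norm_of_nonneg (hc0 n).le] at hz
      calc _ ≤ c n * M * (1 + ‖z‖) := by gcongr; exact hb n z
        _ = (c n + c n * ‖z‖) * M := by ring
        _ ≤ (1 + 2) * M := by gcongr; exact hc1 n
        _ = 3 * M := by ring
    · have : fderiv ℝ φ (c n • z) = 0 := by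
        apply image_eq_zero_of_notMem_tsupport
        intro h
        have := tsupport_fderiv_subset ℝ h
        rw [φ.tsupport_eq] at this
        simp only [Metric.mem_closedBall, dist_zero_right] at this
        exact hz this
      rw [hfd, this]; simp; positivity

theorem aux_div_growth {E : Type*} [NormedAddCommGroup E] [NormedSpace ℝ E] [FiniteDimensional ℝ E]
    [MeasurableSpace E] [BorelSpace E] (ν : Measure E) [ν.IsAddHaarMeasure]
    (W : E → E) (hW : ContDiff ℝ 1 W)
    (hi : Integrable (fun z => ‖W z‖ / (1 + ‖z‖)) ν)
    (hdiv : Integrable (fun z => LinearMap.trace ℝ E (fderiv ℝ W z : E →ₗ[ℝ] E)) ν) :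
    ∫ z, LinearMap.trace ℝ E (fderiv ℝ W z : E →ₗ[ℝ] E) ∂ν = 0 := by
  obtain ⟨χ, M, hM0, hC, hK, h1, hlim, hlim', hbd⟩ := aux_cutoff E
  have hz : ∀ n, ∫ z, (χ n z * LinearMap.trace ℝ E (fderiv ℝ W z : E →ₗ[ℝ] E)
      + fderiv ℝ (χ n) z (W z)) ∂ν = 0 := by
    intro n
    rw [← aux_div_cpt ν (fun z => χ n z • W z) ((hC n).smul hW) ((hK n).smul_right)]
    congr 1; ext z
    exact (aux_trace_smul (χ n) W z ((hC n).differentiable (by norm_num) z)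
      (hW.differentiable (by norm_num) z)).symm
  have ht : Tendsto (fun n => ∫ z, (χ n z * LinearMap.trace ℝ E (fderiv ℝ W z : E →ₗ[ℝ] E)
      + fderiv ℝ (χ n) z (W z)) ∂ν) atTop
      (nhds (∫ z, LinearMap.trace ℝ E (fderiv ℝ W z : E →ₗ[ℝ] E) ∂ν)) := by
    apply tendsto_integral_of_dominated_convergence
      (fun z => ‖LinearMap.trace ℝ E (fderiv ℝ W z : E →ₗ[ℝ] E)‖ + M * (‖W z‖ / (1 + ‖z‖)))
    · intro n
      refine ((hC n).continuous.aestronglyMeasurable.mul hdiv.1).add ?_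
      exact (((hC n).continuous_fderiv (by norm_num)).clm_apply
        hW.continuous).aestronglyMeasurable
    · exact hdiv.norm.add (hi.const_mul M)
    · intro n
      refine Eventually.of_forall fun z => ?_
      refine (norm_add_le _ _).trans (add_le_add ?_ ?_)
      · rw [norm_mul]
        exact mul_le_of_le_one_left (norm_nonneg _) (h1 n z)
      · refine (ContinuousLinearMap.le_opNorm _ _).trans ?_
        have hp : 0 < 1 + ‖z‖ := by positivity
        rw [← mul_div_assoc, le_div_iff₀ hp]
        nlinarith [hbd n z, norm_nonneg (W z)]
    · refine Eventually.of_forall fun z => ?_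
      have a := (hlim z).mul_const (LinearMap.trace ℝ E (fderiv ℝ W z : E →ₗ[ℝ] E))
      have b : Tendsto (fun n => fderiv ℝ (χ n) z (W z)) atTop (nhds 0) := by
        have := ((ContinuousLinearMap.apply ℝ ℝ (W z)).continuous.tendsto 0).comp (hlim' z)
        simpa [Function.comp_def] using this
      simpa using a.add b
  simp_rw [hz] at ht
  exact (tendsto_nhds_unique ht tendsto_const_nhds)

theorem aux_param {E G : Type*} [NormedAddCommGroup E] [NormedSpace ℝ E] [FiniteDimensional ℝ E]
    [NormedAddCommGroup G] [NormedSpace ℝ G] [FiniteDimensional ℝ G]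
    (F : E → ℝ → G) (η : ℝ) (hF : ContDiff ℝ 1 (fun x : E × ℝ => F x.1 x.2)) :
    ContDiff ℝ 1 (fun z => ∫ t in (0:ℝ)..η, F z t) := by
  have : ∀ z t, HasFDerivAt (fun z => F z t)
      ((fderiv ℝ (fun x : E × ℝ => F x.1 x.2) (z, t)).comp (ContinuousLinearMap.inl ℝ E ℝ)) z := by
    intro z t
    have h := (hF.differentiable (by norm_num) (z, t)).hasFDerivAt
    exact HasFDerivAt.comp (f := fun e : E => (e, t)) z h (hasFDerivAt_prodMk_left z t)
  set F' : E → ℝ → E →L[ℝ] G := fun z t =>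
    ((fderiv ℝ (fun x : E × ℝ => F x.1 x.2) (z, t)).comp (ContinuousLinearMap.inl ℝ E ℝ)) with hF'
  have hF'c : Continuous (Function.uncurry F') := by
    have := hF.continuous_fderiv (by norm_num)
    exact (this.clm_comp continuous_const)
  have hFc : Continuous (Function.uncurry F) := hF.continuous
  have hd : ∀ z, HasFDerivAt (fun z => ∫ t in (0:ℝ)..η, F z t) (∫ t in (0:ℝ)..η, F' z t) z := by
    intro z
    obtain ⟨C, hC⟩ := ((isCompact_closedBall z 1).prod (isCompact_uIcc (a := (0:ℝ)) (b := η))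
      ).exists_bound_of_continuousOn hF'c.continuousOn
    refine intervalIntegral.hasFDerivAt_integral_of_dominated_of_fderiv_le (s := Metric.ball z 1)
      (bound := fun _ => C) (Metric.ball_mem_nhds z one_pos) ?_ ?_ ?_ ?_ ?_ ?_
    · refine Eventually.of_forall fun y => ?_
      exact (hFc.comp (continuous_const.prodMk continuous_id)).aestronglyMeasurable
    · exact (hFc.comp (continuous_const.prodMk continuous_id)).intervalIntegrable _ _
    · exact (hF'c.comp (continuous_const.prodMk continuous_id)).aestronglyMeasurable
    · refine Eventually.of_forall fun t ht y hy => ?_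
      exact hC (y, t) ⟨Metric.ball_subset_closedBall hy, Set.uIoc_subset_uIcc ht⟩
    · simp
    · exact Eventually.of_forall fun t ht y hy => this y t
  rw [contDiff_one_iff_fderiv]
  refine ⟨fun z => (hd z).differentiableAt, ?_⟩
  have : fderiv ℝ (fun z => ∫ t in (0:ℝ)..η, F z t) = fun z => ∫ t in (0:ℝ)..η, F' z t := by
    ext1 z; exact (hd z).fderiv
  rw [this]
  exact intervalIntegral.continuous_parametric_intervalIntegral_of_continuous' hF'c 0 η

theorem aux_grad_contDiff (f : Ed d → ℝ) (hf : ContDiff ℝ 2 f) : ContDiff ℝ 1 (gradient f) := by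
  have h : ContDiff ℝ 1 (fderiv ℝ f) := hf.fderiv_right (by norm_num)
  exact (InnerProductSpace.toDual ℝ (Ed d)).symm.contDiff.comp h

theorem aux_descent (f : Ed d → ℝ) (K : ℝ) (hf : ContDiff ℝ 2 f) (hK : LSmooth f K)
    (x h : Ed d) : f (x + h) ≤ f x + ⟪gradient f x, h⟫ + K / 2 * ‖h‖ ^ 2 := by
  have hg := aux_grad_contDiff f hf
  have hline : ∀ s : ℝ, HasDerivAt (fun s : ℝ => x + s • h) h s := by
    intro s
    simpa using ((hasDerivAt_id s).smul_const h).const_add x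
  have h1 : ∀ s : ℝ, HasDerivAt (fun s : ℝ => ⟪gradient f (x + s • h), h⟫)
      (⟪hess f (x + s • h) h, h⟫) s := by
    intro s
    have a : HasDerivAt (fun s : ℝ => gradient f (x + s • h)) (hess f (x + s • h) h) s :=
      HasFDerivAt.comp_hasDerivAt (l := gradient f) (f := fun s : ℝ => x + s • h) s
        (hg.differentiable (by norm_num) (x + s • h)).hasFDerivAt (hline s)
    simpa using a.inner ℝ (hasDerivAt_const s h)
  have h0 : ∀ s : ℝ, HasDerivAt (fun s : ℝ => f (x + s • h))
      (⟪gradient f (x + s • h), h⟫) s := by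
    intro s
    have a := (hf.differentiable (by norm_num) (x + s • h)).hasFDerivAt.comp_hasDerivAt s (hline s)
    have e : fderiv ℝ f (x + s • h) h = ⟪gradient f (x + s • h), h⟫ := by
      simp [gradient]
    rw [← e]; exact a
  -- first derivative bound
  have d1 : ∀ s : ℝ, 0 ≤ s →
      (⟪gradient f (x + s • h), h⟫ : ℝ) ≤ ⟪gradient f x, h⟫ + s * (K * ‖h‖ ^ 2) := by
    intro s hs
    have hder : ∀ s : ℝ, HasDerivAt (fun s : ℝ => (⟪gradient f (x + s • h), h⟫ : ℝ)
        - s * (K * ‖h‖ ^ 2)) (⟪hess f (x + s • h) h, h⟫ - 1 * (K * ‖h‖ ^ 2)) s := fun s =>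
      (h1 s).sub ((hasDerivAt_id s).mul_const _)
    have anti : Antitone (fun s : ℝ => (⟪gradient f (x + s • h), h⟫ : ℝ)
        - s * (K * ‖h‖ ^ 2)) := by
      apply antitone_of_deriv_nonpos (fun s => (hder s).differentiableAt)
      intro s
      rw [(hder s).deriv, real_inner_comm]
      linarith [hK (x + s • h) h]
    have := anti hs
    simp only [zero_smul, add_zero, zero_mul, sub_zero] at this
    linarith
  have hder : ∀ s : ℝ, HasDerivAt (fun s : ℝ => f (x + s • h) - s * ⟪gradient f x, h⟫
      - s ^ 2 * (K / 2 * ‖h‖ ^ 2)) (⟪gradient f (x + s • h), h⟫ - 1 * ⟪gradient f x, h⟫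
      - (2 * s) * (K / 2 * ‖h‖ ^ 2)) s := fun s => by
    have := ((h0 s).sub ((hasDerivAt_id s).mul_const (⟪gradient f x, h⟫ : ℝ))).sub
      ((hasDerivAt_pow 2 s).mul_const (K / 2 * ‖h‖ ^ 2))
    refine this.congr_deriv ?_
    simp
  have anti : AntitoneOn (fun s : ℝ => f (x + s • h) - s * ⟪gradient f x, h⟫
      - s ^ 2 * (K / 2 * ‖h‖ ^ 2)) (Set.Ici 0) := by
    apply antitoneOn_of_deriv_nonpos (convex_Ici 0)
    · exact fun s _ => (hder s).continuousAt.continuousWithinAt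
    · exact fun s _ => (hder s).differentiableAt.differentiableWithinAt
    · intro s hs
      rw [interior_Ici] at hs
      rw [(hder s).deriv]
      have := d1 s (le_of_lt hs)
      linarith
  have := anti (Set.mem_Ici.2 le_rfl) (Set.mem_Ici.2 zero_le_one) zero_le_one
  simp only [zero_smul, add_zero, zero_mul, sub_zero, one_smul, one_mul, one_pow,
    ne_eq, OfNat.ofNat_ne_zero, not_false_eq_true, zero_pow] at this
  linarith

theorem aux_lower (f : Ed d → ℝ) (hf : Continuous f) (h : SubexpTailed f) :
    ∃ lam C : ℝ, 0 < lam ∧ 0 ≤ C ∧ ∀ x, -lam * ‖x‖ - C ≤ f x := by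
  obtain ⟨lam, hl, ht⟩ := h
  have hev := ht.eventually (gt_mem_nhds (zero_lt_one (α := ℝ)))
  rw [(Filter.hasBasis_cocompact).eventually_iff] at hev
  obtain ⟨s, hs, hs'⟩ := hev
  obtain ⟨C, hC⟩ := hs.exists_bound_of_continuousOn hf.continuousOn
  refine ⟨lam, max C 0, hl, le_max_right _ _, fun x => ?_⟩
  have hx := mul_nonneg hl.le (norm_nonneg x)
  by_cases hxs : x ∈ s
  · have := hC x hxs
    rw [Real.norm_eq_abs, abs_le] at this
    linarith [le_max_left C 0, this.1]
  · have := hs' hxs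
    rw [← Real.exp_add, Real.exp_lt_one_iff] at this
    linarith [le_max_right C 0]

theorem aux_grad_growth (f : Ed d → ℝ) (L : ℝ) (hf : ContDiff ℝ 2 f) (hL : LSmooth f L)
    (ht : SubexpTailed f) : ∃ C : ℝ, 0 ≤ C ∧ ∀ x, ‖gradient f x‖ ≤ C * (1 + ‖x‖) := by
  obtain ⟨lam, C, hl, hC, hlow⟩ := aux_lower f hf.continuous ht
  set K := max L 1 with hKdef
  have hK1 : 1 ≤ K := le_max_right _ _
  have hK : LSmooth f K := fun x v => (hL x v).trans
    (mul_le_mul_of_nonneg_right (le_max_left _ _) (by positivity))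
  set a := 2 * K * (|f 0| + ‖gradient f 0‖ + K / 2 + lam + C) with ha
  set b := 2 * lam with hb
  have ha0 : 0 ≤ a := by positivity
  have key : ∀ x, ‖gradient f x‖ ^ 2 ≤ a * (1 + ‖x‖) ^ 2 + b * ‖gradient f x‖ := by
    intro x
    set g := gradient f x with hg
    have h1 := aux_descent f K hf hK x (-(K⁻¹ • g))
    have h2 := aux_descent f K hf hK 0 x
    rw [zero_add] at h2
    have h3 := hlow (x + -(K⁻¹ • g))
    have hn : ‖K⁻¹ • g‖ = K⁻¹ * ‖g‖ := by
      rw [norm_smul, Real.norm_of_nonneg (by positivity)]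
    have h4 : ‖x + -(K⁻¹ • g)‖ ≤ ‖x‖ + K⁻¹ * ‖g‖ := by
      refine (norm_add_le _ _).trans ?_
      rw [norm_neg, hn]
    rw [norm_neg, hn, inner_neg_right, real_inner_smul_right, real_inner_self_eq_norm_sq] at h1
    have h5 : (⟪gradient f 0, x⟫ : ℝ) ≤ ‖gradient f 0‖ * ‖x‖ := real_inner_le_norm _ _
    have h6 : -(K⁻¹ * ‖g‖ ^ 2) + K / 2 * (K⁻¹ * ‖g‖) ^ 2 = -(‖g‖ ^ 2 / (2 * K)) := by
      field_simp; ring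
    have h7 : lam * ‖x + -(K⁻¹ • g)‖ ≤ lam * (‖x‖ + K⁻¹ * ‖g‖) :=
      mul_le_mul_of_nonneg_left h4 hl.le
    have h8 : ‖g‖ ^ 2 / (2 * K) ≤ |f 0| + ‖gradient f 0‖ * ‖x‖ + K / 2 * ‖x‖ ^ 2 +
        lam * (‖x‖ + K⁻¹ * ‖g‖) + C := by
      linarith [le_abs_self (f 0)]
    rw [div_le_iff₀ (by positivity)] at h8
    have h9 : (|f 0| + ‖gradient f 0‖ * ‖x‖ + K / 2 * ‖x‖ ^ 2 + lam * (‖x‖ + K⁻¹ * ‖g‖) + C)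
        * (2 * K) = 2 * K * (|f 0| + ‖gradient f 0‖ * ‖x‖ + K / 2 * ‖x‖ ^ 2 + lam * ‖x‖ + C)
          + b * ‖g‖ := by
      rw [hb]; field_simp; ring
    rw [h9] at h8
    refine h8.trans (add_le_add_left ?_ _)
    rw [ha, mul_assoc (2 * K)]
    refine mul_le_mul_of_nonneg_left ?_ (by positivity)
    have hx := norm_nonneg x
    have e1 : 1 ≤ (1 + ‖x‖) ^ 2 := by nlinarith
    have e2 : ‖x‖ ≤ (1 + ‖x‖) ^ 2 := by nlinarith
    have e3 : ‖x‖ ^ 2 ≤ (1 + ‖x‖) ^ 2 := by nlinarith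
    have q1 := mul_le_mul_of_nonneg_left e1 (abs_nonneg (f 0))
    have q2 := mul_le_mul_of_nonneg_left e2 (norm_nonneg (gradient f 0))
    have q3 := mul_le_mul_of_nonneg_left e3 (show 0 ≤ K / 2 by positivity)
    have q4 := mul_le_mul_of_nonneg_left e2 hl.le
    have q5 := mul_le_mul_of_nonneg_left e1 hC
    linarith
  refine ⟨a + b + 1, by positivity, fun x => ?_⟩
  by_contra hcon
  push Not at hcon
  have hk := key x
  have hx := norm_nonneg x
  set G := ‖gradient f x‖
  have hb0 : 0 ≤ b := by positivity
  have hGx : 1 + ‖x‖ ≤ G := by nlinarith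
  have hG : 0 < G := by linarith
  have r1 : (a + b + 1) * (1 + ‖x‖) * G < G * G := mul_lt_mul_of_pos_right hcon hG
  have r2 : a * (1 + ‖x‖) * (1 + ‖x‖) ≤ a * (1 + ‖x‖) * G :=
    mul_le_mul_of_nonneg_left hGx (by positivity)
  have r3 : 0 ≤ b * ‖x‖ * G := by positivity
  have r4 : 0 ≤ (1 + ‖x‖) * G := by positivity
  nlinarith

theorem aux_leapQ_contDiff (f : Ed d → ℝ) (hf : ContDiff ℝ 2 f) :
    ContDiff ℝ 1 (fun x : (Ed d × Ed d) × ℝ => leapQ f x.2 x.1.1 x.1.2) := by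
  have hg := aux_grad_contDiff f hf
  unfold leapQ
  fun_prop

theorem aux_vEta_contDiff (f : Ed d → ℝ) (η : ℝ) (hf : ContDiff ℝ 2 f) :
    ContDiff ℝ 1 (vEta f η) := by
  have hg := aux_grad_contDiff f hf
  have h1 : ContDiff ℝ 1 (fun x : (Ed d × Ed d) × ℝ => gradient f (leapQ f x.2 x.1.1 x.1.2)) :=
    hg.comp (aux_leapQ_contDiff f hf)
  have h2 : ContDiff ℝ 1 (fun x : (Ed d × Ed d) × ℝ => gradient f (leapQ f η x.1.1 x.1.2)) := by
    refine hg.comp ?_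
    unfold leapQ
    fun_prop
  have h3 : ContDiff ℝ 1 (fun x : (Ed d × Ed d) × ℝ => gradient f x.1.1) := by
    fun_prop
  have p1 : ContDiff ℝ 1 (fun x : (Ed d × Ed d) × ℝ => x.2 • (gradient f (leapQ f x.2 x.1.1 x.1.2)
      - gradient f (leapQ f η x.1.1 x.1.2))) := contDiff_snd.smul (h1.sub h2)
  have p2 : ContDiff ℝ 1 (fun x : (Ed d × Ed d) × ℝ => gradient f (leapQ f x.2 x.1.1 x.1.2)
      - (2⁻¹ : ℝ) • gradient f x.1.1 - (2⁻¹ : ℝ) • gradient f (leapQ f η x.1.1 x.1.2)) :=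
    (h1.sub (h3.const_smul _)).sub (h2.const_smul _)
  have q1 := aux_param (E := Ed d × Ed d) (G := Ed d)
    (fun z t => t • (gradient f (leapQ f t z.1 z.2) - gradient f (leapQ f η z.1 z.2))) η p1
  have q2 := aux_param (E := Ed d × Ed d) (G := Ed d)
    (fun z t => gradient f (leapQ f t z.1 z.2) - (2⁻¹ : ℝ) • gradient f z.1
       - (2⁻¹ : ℝ) • gradient f (leapQ f η z.1 z.2)) η p2
  have := q1.neg.prodMk q2
  exact this

theorem aux_vEta_growth (f : Ed d → ℝ) (η : ℝ) (C : ℝ) (hC : 0 ≤ C)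
    (hg : ∀ x, ‖gradient f x‖ ≤ C * (1 + ‖x‖)) :
    ∃ D : ℝ, 0 ≤ D ∧ ∀ z, ‖vEta f η z‖ ≤ D * (1 + ‖z‖) := by
  set A := C * (1 + (1 + |η| + |η| ^ 2 * C)) with hA
  have hA0 : 0 ≤ A := by positivity
  have hq : ∀ (t : ℝ) (z : Ed d × Ed d), |t| ≤ |η| → ‖gradient f (leapQ f t z.1 z.2)‖ ≤ A * (1 + ‖z‖) := by
    intro t z ht
    refine (hg _).trans ?_
    rw [hA, mul_assoc]
    refine mul_le_mul_of_nonneg_left ?_ hC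
    have hz1 := norm_fst_le z
    have hz2 := norm_snd_le z
    have hz := norm_nonneg z
    have e1 : ‖leapQ f t z.1 z.2‖ ≤ ‖z.1‖ + |t| * ‖z.2‖ + t ^ 2 / 2 * ‖gradient f z.1‖ := by
      unfold leapQ
      refine (norm_sub_le _ _).trans (add_le_add ((norm_add_le _ _).trans (add_le_add le_rfl ?_)) ?_)
      · rw [norm_smul, Real.norm_eq_abs]
      · rw [norm_smul, Real.norm_of_nonneg (by positivity)]
    have e2 : |t| * ‖z.2‖ ≤ |η| * (1 + ‖z‖) := by gcongr; linarith
    have e3 : t ^ 2 / 2 * ‖gradient f z.1‖ ≤ |η| ^ 2 * (C * (1 + ‖z‖)) := by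
      have : t ^ 2 / 2 ≤ |η| ^ 2 := by
        rw [← sq_abs t]; nlinarith [abs_nonneg t, abs_nonneg η]
      refine mul_le_mul this ((hg _).trans ?_) (norm_nonneg _) (by positivity)
      gcongr
    have : 1 + ‖leapQ f t z.1 z.2‖ ≤ 1 + (‖z‖ + |η| * (1 + ‖z‖) + |η| ^ 2 * (C * (1 + ‖z‖))) := by
      linarith
    refine this.trans ?_
    linarith
  have hq0 : ∀ z : Ed d × Ed d, ‖gradient f z.1‖ ≤ A * (1 + ‖z‖) := by
    intro z
    simpa [leapQ] using hq 0 z (by simp)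
  set D1 := |η| * (2 * A) * |η| with hD1
  set D2 := (2 * A) * |η| with hD2
  have hbt : ∀ t ∈ Set.uIoc 0 η, |t| ≤ |η| := by
    intro t ht
    have := Set.abs_sub_left_of_mem_uIcc (Set.uIoc_subset_uIcc ht)
    simpa using this
  refine ⟨D1 + D2, by positivity, fun z => ?_⟩
  have hz : 0 ≤ 1 + ‖z‖ := by positivity
  have v1 : ‖(vEta f η z).1‖ ≤ D1 * (1 + ‖z‖) := by
    simp only [vEta, norm_neg]
    have := intervalIntegral.norm_integral_le_of_norm_le_const (a := 0) (b := η)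
      (C := |η| * (2 * A) * (1 + ‖z‖))
      (f := fun t => t • (gradient f (leapQ f t z.1 z.2) - gradient f (leapQ f η z.1 z.2))) (by
        intro t ht
        rw [norm_smul, Real.norm_eq_abs, mul_assoc]
        refine mul_le_mul (hbt t ht) ?_ (norm_nonneg _) (abs_nonneg _)
        refine (norm_sub_le _ _).trans ?_
        linarith [hq t z (hbt t ht), hq η z le_rfl])
    refine this.trans (le_of_eq ?_)
    rw [sub_zero, hD1]; ring
  have v2 : ‖(vEta f η z).2‖ ≤ D2 * (1 + ‖z‖) := by
    simp only [vEta]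
    have := intervalIntegral.norm_integral_le_of_norm_le_const (a := 0) (b := η)
      (C := (2 * A) * (1 + ‖z‖))
      (f := fun t => (gradient f (leapQ f t z.1 z.2) - (2⁻¹ : ℝ) • gradient f z.1
       - (2⁻¹ : ℝ) • gradient f (leapQ f η z.1 z.2))) (by
        intro t ht
        refine (norm_sub_le _ _).trans (add_le_add_left (norm_sub_le _ _) _ |>.trans ?_)
        rw [norm_smul, norm_smul, Real.norm_of_nonneg (by norm_num : (0:ℝ) ≤ 2⁻¹)]
        linarith [hq t z (hbt t ht), hq η z le_rfl, hq0 z])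
    refine this.trans (le_of_eq ?_)
    rw [sub_zero, hD2]; ring
  rw [Prod.norm_def]
  have k1 : 0 ≤ D1 * (1 + ‖z‖) := by positivity
  have k2 : 0 ≤ D2 * (1 + ‖z‖) := by positivity
  apply max_le <;> linarith

theorem aux_gauss_integrable :
    Integrable (fun p : Ed d => Real.exp (-‖p‖ ^ 2 / 2)) volume := by
  have h := GaussianFourier.integrable_cexp_neg_mul_sq_norm_add (V := Ed d) (b := 1 / 2)
    (by norm_num) 0 0
  refine h.norm.congr (Eventually.of_forall fun p => ?_)
  simp only [Complex.norm_exp]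
  congr 1
  have : (-(1 / 2 : ℂ) * (‖p‖ : ℂ) ^ 2 + 0 * ((inner ℝ (0 : Ed d) p : ℝ) : ℂ))
    = ((-‖p‖ ^ 2 / 2 : ℝ) : ℂ) := by push_cast; ring
  rw [this, Complex.ofReal_re]

theorem aux_gauss_finite : IsFiniteMeasure (stdGaussian d) := by
  unfold stdGaussian
  exact isFiniteMeasure_withDensity_ofReal (aux_gauss_integrable.const_mul _).2

theorem aux_measure (f : Ed d → ℝ) (hf : Continuous f) (μ : Measure (Ed d)) (hμ : IsGibbs f μ) :
    ∃ c : ℝ, 0 < c ∧ μ.prod (stdGaussian d) = (volume : Measure (Ed d × Ed d)).withDensity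
      (fun z => ENNReal.ofReal (c * Real.exp (-f z.1 - ‖z.2‖ ^ 2 / 2))) := by
  obtain ⟨_, Z, hZ, hs⟩ := hμ
  have hμ' : μ = volume.withDensity (fun x => ENNReal.ofReal (Z⁻¹ * Real.exp (-f x))) := by
    ext s hsm
    rw [hs s hsm, withDensity_apply _ hsm, ← lintegral_const_mul' _ _ ENNReal.ofReal_ne_top]
    congr 1; ext x
    rw [ENNReal.ofReal_mul (by positivity)]
  refine ⟨Z⁻¹ * (2 * π) ^ (-(d : ℝ) / 2), by positivity, ?_⟩
  rw [hμ', stdGaussian, prod_withDensity (by fun_prop) (by fun_prop)]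
  rw [← Measure.volume_eq_prod]
  congr 1; ext z
  rw [← ENNReal.ofReal_mul (by positivity)]
  congr 1
  rw [show -f z.1 - ‖z.2‖ ^ 2 / 2 = -f z.1 + -‖z.2‖ ^ 2 / 2 by ring, Real.exp_add]
  ring

theorem aux_final (f : Ed d → ℝ) (c : ℝ) (hc : 0 < c) (hf : ContDiff ℝ 2 f)
    (ν : Measure (Ed d × Ed d)) [IsFiniteMeasure ν]
    (hν : ν = (volume : Measure (Ed d × Ed d)).withDensity
      (fun z => ENNReal.ofReal (c * Real.exp (-f z.1 - ‖z.2‖ ^ 2 / 2))))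
    (v : Ed d × Ed d → Ed d × Ed d) (hv : ContDiff ℝ 1 v) (D : ℝ) (hD : 0 ≤ D)
    (hgrow : ∀ z, ‖v z‖ ≤ D * (1 + ‖z‖)) (m : ℕ)
    (B TrDv A₂ A₃ : Ed d × Ed d → ℝ)
    (hB : B = fun z => (⟪(v z).1, gradient f z.1⟫ : ℝ) + (⟪(v z).2, z.2⟫ : ℝ))
    (hTr : TrDv = fun z => LinearMap.trace ℝ (Ed d × Ed d)
      ((fderiv ℝ v z : Ed d × Ed d →ₗ[ℝ] Ed d × Ed d)))
    (hA₂ : A₂ = fun z =>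
      (⟪(v z).1, hess f z.1 (v z).1⟫ : ℝ) + ‖(v z).2‖ ^ 2)
    (hA₃ : A₃ = fun z =>
      (⟪gradient f z.1, (fderiv ℝ v z (v z)).1⟫ : ℝ)
        + (⟪z.2, (fderiv ℝ v z (v z)).2⟫ : ℝ))
    (h₁ : Integrable (fun z => B z ^ (m + 2)) ν)
    (h₂ : Integrable (fun z => B z ^ (m + 1) * TrDv z) ν)
    (h₃ : Integrable (fun z => B z ^ m * A₂ z) ν)
    (h₄ : Integrable (fun z => B z ^ m * A₃ z) ν) :
    ∫ z, B z ^ (m + 2) ∂ν = ∫ z, B z ^ (m + 1) * TrDv z ∂ν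
        + ((m : ℝ) + 1) * ∫ z, B z ^ m * A₂ z ∂ν
        + ((m : ℝ) + 1) * ∫ z, B z ^ m * A₃ z ∂ν := by
  have hg := aux_grad_contDiff f hf
  have hgd := hg.differentiable (by norm_num)
  have hvd := hv.differentiable (by norm_num)
  set r : Ed d × Ed d → ℝ := fun z => c * Real.exp (-f z.1 - ‖z.2‖ ^ 2 / 2) with hr
  have hr0 : ∀ z, 0 ≤ r z := fun z => by positivity
  have hf1 : ContDiff ℝ 1 f := hf.of_le (by norm_num)
  have hrC : ContDiff ℝ 1 r := by
    have : ContDiff ℝ 1 (fun z : Ed d × Ed d => ‖z.2‖ ^ 2) := contDiff_snd.norm_sq ℝ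
    have h2 : ContDiff ℝ 1 (fun z : Ed d × Ed d => f z.1) := hf1.comp contDiff_fst
    exact contDiff_const.mul ((h2.neg.sub (this.div_const 2)).exp)
  have hBC : ContDiff ℝ 1 B := by
    rw [hB]
    exact (hv.fst.inner ℝ (hg.comp contDiff_fst)).add (hv.snd.inner ℝ contDiff_snd)
  have hrm : Measurable (fun z => ENNReal.ofReal (r z)) := hrC.continuous.measurable.ennreal_ofReal
  have hint : ∀ g : Ed d × Ed d → ℝ, Integrable g ν ↔ Integrable (fun z => r z * g z) volume := by
    intro g
    rw [hν, integrable_withDensity_iff_integrable_smul' hrm (by simp)]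
    simp [ENNReal.toReal_ofReal (hr0 _)]
  have hval : ∀ g : Ed d × Ed d → ℝ, ∫ z, g z ∂ν = ∫ z, r z * g z := by
    intro g
    rw [hν, integral_withDensity_eq_integral_toReal_smul hrm (by simp)]
    simp [ENNReal.toReal_ofReal (hr0 _)]
  -- derivative of r and B along v
  have hdr : ∀ z, fderiv ℝ r z (v z) = - r z * B z := by
    intro z
    have e1 : HasFDerivAt (fun z : Ed d × Ed d => f z.1)
        ((fderiv ℝ f z.1).comp (ContinuousLinearMap.fst ℝ (Ed d) (Ed d))) z :=
      HasFDerivAt.comp (g := f) (f := Prod.fst) z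
        (hf1.differentiable (by norm_num) z.1).hasFDerivAt hasFDerivAt_fst
    have e2 : HasFDerivAt (fun z : Ed d × Ed d => ‖z.2‖ ^ 2) _ z :=
      (hasFDerivAt_snd (𝕜 := ℝ) (p := z)).norm_sq
    have e20 := e2.mul_const (2⁻¹ : ℝ)
    have e3 := ((e1.neg.sub e20).exp).const_mul c
    have e4 := e3.congr_of_eventuallyEq (f₁ := r)
      (Eventually.of_forall fun y => by simp [hr, div_eq_mul_inv])
    rw [e4.fderiv]
    simp [hB, hr, div_eq_mul_inv, real_inner_comm]
    ring
  have hdB : ∀ z, fderiv ℝ B z (v z) = A₂ z + A₃ z := by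
    intro z
    have e1 : HasFDerivAt (fun z : Ed d × Ed d => gradient f z.1)
        ((hess f z.1).comp (ContinuousLinearMap.fst ℝ (Ed d) (Ed d))) z :=
      HasFDerivAt.comp (g := gradient f) (f := Prod.fst) z
        (hgd z.1).hasFDerivAt hasFDerivAt_fst
    have e3 := (((hvd z).hasFDerivAt.fst).inner ℝ e1).add
      (((hvd z).hasFDerivAt.snd).inner ℝ (hasFDerivAt_snd (𝕜 := ℝ) (p := z)))
    have e4 := e3.congr_of_eventuallyEq (f₁ := B)
      (Eventually.of_forall fun y => by simp [hB])
    rw [e4.fderiv, hA₂, hA₃]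
    simp [-inner_gradient_left, -inner_gradient_right, real_inner_comm]
    ring
  set W : Ed d × Ed d → Ed d × Ed d := fun z => (r z * B z ^ (m + 1)) • v z with hW
  have hgC : ContDiff ℝ 1 (fun z => r z * B z ^ (m + 1)) := hrC.mul (hBC.pow _)
  have htr : ∀ z, LinearMap.trace ℝ (Ed d × Ed d)
      ((fderiv ℝ W z : Ed d × Ed d →ₗ[ℝ] Ed d × Ed d))
      = r z * (B z ^ (m + 1) * TrDv z + ((m : ℝ) + 1) * (B z ^ m * A₂ z)
        + ((m : ℝ) + 1) * (B z ^ m * A₃ z) - B z ^ (m + 2)) := by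
    intro z
    rw [hW, aux_trace_smul _ v z (hgC.differentiable (by norm_num) z) (hvd z), hTr]
    have e := ((hrC.differentiable (by norm_num) z).hasFDerivAt.mul
      ((hBC.differentiable (by norm_num) z).hasFDerivAt.pow (m + 1))).fderiv
    have e' : fderiv ℝ (fun z => r z * B z ^ (m + 1)) z (v z)
        = r z * ((m + 1) * B z ^ m * (A₂ z + A₃ z)) + B z ^ (m + 1) * (- r z * B z) := by
      rw [← hdr, ← hdB]
      have e'' : fderiv ℝ (fun z => r z * B z ^ (m + 1)) z = _ := e
      rw [e'']
      simp
    rw [e']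
    ring
  have hsum : Integrable (fun z => B z ^ (m + 1) * TrDv z + ((m : ℝ) + 1) * (B z ^ m * A₂ z)
        + ((m : ℝ) + 1) * (B z ^ m * A₃ z) - B z ^ (m + 2)) ν :=
    ((h₂.add (h₃.const_mul _)).add (h₄.const_mul _)).sub h₁
  have hHaar : (volume : Measure (Ed d × Ed d)).IsAddHaarMeasure := by
    rw [Measure.volume_eq_prod]; infer_instance
  have hzero := aux_div_growth (volume : Measure (Ed d × Ed d)) W (hgC.smul hv) (by
    have hb : Integrable (fun z => D * (1 + |B z ^ (m + 2)|)) ν :=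
      ((integrable_const 1).add h₁.abs).const_mul D
    rw [hint] at hb
    refine hb.mono' ?_ (Eventually.of_forall fun z => ?_)
    · refine Continuous.aestronglyMeasurable ?_
      exact (hgC.smul hv).continuous.norm.div (by fun_prop) (fun z => by positivity)
    · have hp : 0 < 1 + ‖z‖ := by positivity
      rw [Real.norm_of_nonneg (by positivity), div_le_iff₀ hp, hW]
      simp only [norm_smul, norm_mul, Real.norm_of_nonneg (hr0 z), norm_pow, Real.norm_eq_abs]
      have hBp : |B z| ^ (m + 1) ≤ 1 + |B z ^ (m + 2)| := by
        rw [abs_pow]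
        rcases le_total (|B z|) 1 with h | h
        · have := pow_le_one₀ (n := m + 1) (abs_nonneg (B z)) h
          have : 0 ≤ |B z| ^ (m + 2) := by positivity
          linarith
        · have := pow_le_pow_right₀ h (show m + 1 ≤ m + 2 by omega)
          linarith
      calc r z * |B z| ^ (m + 1) * ‖v z‖ ≤ r z * (1 + |B z ^ (m + 2)|) * (D * (1 + ‖z‖)) := by
            have := hr0 z
            gcongr
            exact hgrow z
        _ = _ := by ring)
    (by simp_rw [htr]; exact (hint _).1 hsum)
  simp_rw [htr] at hzero
  have s1 : Integrable (fun z => B z ^ (m + 1) * TrDv z + ((m : ℝ) + 1) * (B z ^ m * A₂ z)) ν :=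
    h₂.add (h₃.const_mul _)
  have s2 : Integrable (fun z => B z ^ (m + 1) * TrDv z + ((m : ℝ) + 1) * (B z ^ m * A₂ z)
        + ((m : ℝ) + 1) * (B z ^ m * A₃ z)) ν := s1.add (h₄.const_mul _)
  rw [← hval, integral_sub s2 h₁, integral_add s1 (h₄.const_mul _),
    integral_add h₂ (h₃.const_mul _), integral_const_mul, integral_const_mul] at hzero
  linarith

/-- integration-by-parts identity for `E[B_η^ℓ]`. -/
theorem B_eta_integration_by_parts {d : ℕ} (f : Ed d → ℝ) (L η : ℝ) (μ : Measure (Ed d))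
    (ℓ : ℕ) (hℓ : 2 ≤ ℓ) (hf : ContDiff ℝ 2 f) (hL : LSmooth f L) (htail : SubexpTailed f)
    (hμ : IsGibbs f μ)
    (B TrDv A₂ A₃ : Ed d × Ed d → ℝ)
    (hB : B = fun z => (⟪(vEta f η z).1, gradient f z.1⟫ : ℝ) + (⟪(vEta f η z).2, z.2⟫ : ℝ))
    (hTr : TrDv = fun z => LinearMap.trace ℝ (Ed d × Ed d)
      ((fderiv ℝ (vEta f η) z : Ed d × Ed d →ₗ[ℝ] Ed d × Ed d)))
    (hA₂ : A₂ = fun z =>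
      (⟪(vEta f η z).1, hess f z.1 (vEta f η z).1⟫ : ℝ) + ‖(vEta f η z).2‖ ^ 2)
    (hA₃ : A₃ = fun z =>
      (⟪gradient f z.1, (fderiv ℝ (vEta f η) z (vEta f η z)).1⟫ : ℝ)
        + (⟪z.2, (fderiv ℝ (vEta f η) z (vEta f η z)).2⟫ : ℝ))
    (h₁ : Integrable (fun z => B z ^ ℓ) (μ.prod (stdGaussian d)))
    (h₂ : Integrable (fun z => B z ^ (ℓ - 1) * TrDv z) (μ.prod (stdGaussian d)))
    (h₃ : Integrable (fun z => B z ^ (ℓ - 2) * A₂ z) (μ.prod (stdGaussian d)))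
    (h₄ : Integrable (fun z => B z ^ (ℓ - 2) * A₃ z) (μ.prod (stdGaussian d))) :
    ∫ z, B z ^ ℓ ∂(μ.prod (stdGaussian d))
      = ∫ z, B z ^ (ℓ - 1) * TrDv z ∂(μ.prod (stdGaussian d))
        + ((ℓ : ℝ) - 1) * ∫ z, B z ^ (ℓ - 2) * A₂ z ∂(μ.prod (stdGaussian d))
        + ((ℓ : ℝ) - 1) * ∫ z, B z ^ (ℓ - 2) * A₃ z ∂(μ.prod (stdGaussian d)) := by
  obtain ⟨C, hC, hgr⟩ := aux_grad_growth f L hf hL htail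
  obtain ⟨D, hD, hgrow⟩ := aux_vEta_growth f η C hC hgr
  obtain ⟨c, hc, hν⟩ := aux_measure f hf.continuous μ hμ
  have := hμ.1
  have := aux_gauss_finite (d := d)
  obtain ⟨m, rfl⟩ : ∃ m, ℓ = m + 2 := ⟨ℓ - 2, by omega⟩
  have e1 : m + 2 - 1 = m + 1 := by omega
  have e2 : m + 2 - 2 = m := by omega
  rw [e1] at h₂ ⊢
  rw [e2] at h₃ h₄ ⊢
  have e3 : ((m + 2 : ℕ) : ℝ) - 1 = (m : ℝ) + 1 := by push_cast; ring
  rw [e3]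
  exact aux_final f c hc hf _ hν (vEta f η) (aux_vEta_contDiff f η hf) D hD hgrow m B TrDv A₂ A₃
    hB hTr hA₂ hA₃ h₁ h₂ h₃ h₄

end
end

section
/- Let ℓ ≥ 2 be an integer and let f : ℝ^d → ℝ be twice continuously differentiable and L-smooth with μ ∝ e^{-f} subexponential-tailed, and suppose the expectations below are finite. Then E_{q ∼ μ} ‖∇f(q)‖^{2ℓ} = E_{q ∼ μ}[‖∇f(q)‖^{2(ℓ−1)}·trace(∇²f(q))] + 2(ℓ−1)·E_{q ∼ μ}[‖∇f(q)‖^{2(ℓ−2)}·∇f(q)ᵀ∇²f(q)∇f(q)]. -/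
open MeasureTheory Real Filter
open scoped ENNReal RealInnerProductSpace

noncomputable section

variable {d : ℕ}

/-- Integration by parts against a compactly supported cutoff. -/
theorem aux_ibp_cutoff (χ : Ed d → ℝ) (V : Ed d → Ed d) (hχ : ContDiff ℝ 1 χ)
    (hc : HasCompactSupport χ) (hV : ContDiff ℝ 1 V) :
    ∫ x, χ x * LinearMap.trace ℝ (Ed d) (fderiv ℝ V x : Ed d →ₗ[ℝ] Ed d)
      = - ∫ x, fderiv ℝ χ x (V x) := by
  let b := EuclideanSpace.basisFun (Fin d) ℝ
  have hVd : ∀ x, DifferentiableAt ℝ V x := fun x => hV.differentiable one_ne_zero x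
  have hg : ∀ i, ContDiff ℝ 1 (fun x => ⟪b i, V x⟫) := fun i => contDiff_const.inner ℝ hV
  have hgd : ∀ i x v, fderiv ℝ (fun x => ⟪b i, V x⟫) x v = ⟪b i, fderiv ℝ V x v⟫ := by
    intro i x v
    have h := ((innerSL ℝ (b i)).hasFDerivAt (x := V x)).comp x (hVd x).hasFDerivAt
    have h2 : HasFDerivAt (fun x => ⟪b i, V x⟫) ((innerSL ℝ (b i)).comp (fderiv ℝ V x)) x := h
    rw [h2.fderiv]; simp
  have hχ' : Continuous (fderiv ℝ χ) := hχ.continuous_fderiv one_ne_zero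
  have hV' : Continuous (fderiv ℝ V) := hV.continuous_fderiv one_ne_zero
  have hc' : HasCompactSupport (fderiv ℝ χ) := hc.fderiv ℝ
  have i1 : ∀ i, Integrable (fun x => fderiv ℝ χ x (b i) * ⟪b i, V x⟫) := by
    intro i
    refine Continuous.integrable_of_hasCompactSupport ?_ ?_
    · exact (hχ'.clm_apply continuous_const).mul (hg i).continuous
    · refine hc'.mono ?_
      intro x hx
      simp only [Function.mem_support] at hx ⊢
      intro h; apply hx; simp [h]
  have i2 : ∀ i, Integrable (fun x => χ x * ⟪b i, fderiv ℝ V x (b i)⟫) := by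
    intro i
    refine Continuous.integrable_of_hasCompactSupport ?_ ?_
    · exact hχ.continuous.mul (continuous_const.inner (hV'.clm_apply continuous_const))
    · exact hc.mul_right
  have key : ∀ i, ∫ x, χ x * ⟪b i, fderiv ℝ V x (b i)⟫
      = - ∫ x, fderiv ℝ χ x (b i) * ⟪b i, V x⟫ := by
    intro i
    have := integral_mul_fderiv_eq_neg_fderiv_mul_of_integrable (μ := (volume : Measure (Ed d)))
      (f := χ) (g := fun x => ⟪b i, V x⟫) (v := b i) (i1 i)
      (by simpa only [hgd] using i2 i)
      (((hχ.continuous.mul (hg i).continuous)).integrable_of_hasCompactSupport hc.mul_right)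
      (fun x _ => hχ.differentiable one_ne_zero x) (fun x _ => (hg i).differentiable one_ne_zero x)
    simpa only [hgd] using this
  have e1 : ∀ x, χ x * LinearMap.trace ℝ (Ed d) (fderiv ℝ V x : Ed d →ₗ[ℝ] Ed d)
      = ∑ i, χ x * ⟪b i, fderiv ℝ V x (b i)⟫ := by
    intro x
    rw [LinearMap.trace_eq_sum_inner _ b, Finset.mul_sum]; rfl
  have e2 : ∀ x, fderiv ℝ χ x (V x) = ∑ i, fderiv ℝ χ x (b i) * ⟪b i, V x⟫ := by
    intro x
    conv_lhs => rw [← b.sum_repr' (V x)]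
    simp [map_sum, mul_comm]
  simp_rw [e1, e2]
  rw [integral_finsetSum _ (fun i _ => i2 i), integral_finsetSum _ (fun i _ => i1 i),
    ← Finset.sum_neg_distrib]
  exact Finset.sum_congr rfl fun i _ => key i

/-- The divergence theorem on the whole space for integrable fields of integrable divergence. -/
theorem aux_div_zero (V : Ed d → Ed d) (hV : ContDiff ℝ 1 V) (hi : Integrable V)
    (hdiv : Integrable
      (fun x => LinearMap.trace ℝ (Ed d) (fderiv ℝ V x : Ed d →ₗ[ℝ] Ed d))) :
    ∫ x, LinearMap.trace ℝ (Ed d) (fderiv ℝ V x : Ed d →ₗ[ℝ] Ed d) = 0 := by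
  let φ : ContDiffBump (0 : Ed d) := ⟨1, 2, one_pos, one_lt_two⟩
  let c : ℕ → ℝ := fun n => 1 / ((n : ℝ) + 1)
  have hc0 : ∀ n, c n ≠ 0 := fun n => by positivity
  have hclim : Tendsto c atTop (nhds 0) := tendsto_one_div_add_atTop_nhds_zero_nat
  have hφ : ContDiff ℝ 1 (φ : Ed d → ℝ) := φ.contDiff
  have hφ' : Continuous (fderiv ℝ (φ : Ed d → ℝ)) := hφ.continuous_fderiv one_ne_zero
  obtain ⟨C, hC⟩ := (φ.hasCompactSupport.fderiv ℝ).exists_bound_of_continuous hφ'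
  have hfd : ∀ n x, fderiv ℝ (fun x => φ (c n • x)) x = c n • fderiv ℝ (φ : Ed d → ℝ) (c n • x) := by
    intro n x
    have h1 : HasFDerivAt (fun x : Ed d => c n • x) (c n • ContinuousLinearMap.id ℝ (Ed d)) x :=
      (hasFDerivAt_id x).const_smul (c n)
    have h2 := ((hφ.differentiable one_ne_zero (c n • x)).hasFDerivAt).comp x h1
    have h3 : HasFDerivAt (fun x => φ (c n • x)) _ x := h2
    rw [h3.fderiv]; ext v; simp
  have hsx : ∀ x : Ed d, Tendsto (fun n => c n • x) atTop (nhds 0) := fun x => by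
    simpa using hclim.smul_const x
  have hL : Tendsto (fun n => ∫ x, φ (c n • x) *
      LinearMap.trace ℝ (Ed d) (fderiv ℝ V x : Ed d →ₗ[ℝ] Ed d)) atTop
      (nhds (∫ x, LinearMap.trace ℝ (Ed d) (fderiv ℝ V x : Ed d →ₗ[ℝ] Ed d))) := by
    refine tendsto_integral_of_dominated_convergence
      (fun x => ‖LinearMap.trace ℝ (Ed d) (fderiv ℝ V x : Ed d →ₗ[ℝ] Ed d)‖) ?_ hdiv.norm ?_ ?_
    · intro n
      exact (hφ.continuous.comp (continuous_const_smul (c n))).aestronglyMeasurable.mul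
        hdiv.aestronglyMeasurable
    · intro n
      refine Eventually.of_forall fun x => ?_
      rw [norm_mul]
      refine mul_le_of_le_one_left (norm_nonneg _) ?_
      rw [Real.norm_of_nonneg φ.nonneg]
      exact φ.le_one
    · refine Eventually.of_forall fun x => ?_
      have h := (hφ.continuous.tendsto 0).comp (hsx x)
      have h0 : φ (0 : Ed d) = 1 := φ.one_of_mem_closedBall (by simp [φ])
      rw [h0] at h
      simpa using h.mul_const (LinearMap.trace ℝ (Ed d) (fderiv ℝ V x : Ed d →ₗ[ℝ] Ed d))
  have hR : Tendsto (fun n => ∫ x, fderiv ℝ (fun x => φ (c n • x)) x (V x)) atTop (nhds 0) := by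
    have h0 : Tendsto (fun n => c n * (C * ∫ x, ‖V x‖)) atTop (nhds 0) := by
      simpa using hclim.mul_const (C * ∫ x, ‖V x‖)
    refine squeeze_zero_norm (fun n => ?_) h0
    have hcn : 0 ≤ c n := by positivity
    rw [← integral_const_mul, ← integral_const_mul]
    refine norm_integral_le_of_norm_le ((hi.norm.const_mul C).const_mul (c n)) ?_
    refine Eventually.of_forall fun x => ?_
    rw [hfd, _root_.smul_apply, norm_smul, Real.norm_of_nonneg hcn]
    refine mul_le_mul_of_nonneg_left ?_ hcn
    exact (ContinuousLinearMap.le_opNorm _ _).trans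
      (mul_le_mul_of_nonneg_right (hC _) (norm_nonneg _))
  have heq : ∀ n, ∫ x, φ (c n • x) *
      LinearMap.trace ℝ (Ed d) (fderiv ℝ V x : Ed d →ₗ[ℝ] Ed d)
      = - ∫ x, fderiv ℝ (fun x => φ (c n • x)) x (V x) := by
    intro n
    refine aux_ibp_cutoff _ V (hφ.comp (contDiff_const_smul (c n))) ?_ hV
    exact φ.hasCompactSupport.comp_smul (hc0 n)
  simp_rw [heq] at hL
  simpa using tendsto_nhds_unique hL hR.neg

theorem aux_trace (a : ℝ) (T : Ed d →L[ℝ] Ed d) (A : Ed d →L[ℝ] ℝ) (v : Ed d) :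
    LinearMap.trace ℝ (Ed d) ((a • T + A.smulRight v : Ed d →L[ℝ] Ed d) : Ed d →ₗ[ℝ] Ed d)
      = a * LinearMap.trace ℝ (Ed d) (T : Ed d →ₗ[ℝ] Ed d) + A v := by
  have h : ((a • T + A.smulRight v : Ed d →L[ℝ] Ed d) : Ed d →ₗ[ℝ] Ed d)
      = a • (T : Ed d →ₗ[ℝ] Ed d) + (A : Ed d →ₗ[ℝ] ℝ).smulRight v := rfl
  rw [h, map_add, map_smul, LinearMap.trace_smulRight]
  rfl

/-- Divergence of `‖∇f‖^{2(k+1)} e^{-f} ∇f`. -/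
theorem aux_div_formula (f : Ed d → ℝ) (hf : ContDiff ℝ 2 f) (k : ℕ) (x : Ed d) :
    LinearMap.trace ℝ (Ed d) (fderiv ℝ (fun q => (‖gradient f q‖ ^ (2 * (k + 1)) *
        Real.exp (-f q)) • gradient f q) x : Ed d →ₗ[ℝ] Ed d)
      = Real.exp (-f x) * (‖gradient f x‖ ^ (2 * (k + 1)) * hessTrace f x)
        + 2 * ((k : ℝ) + 1) * (Real.exp (-f x) * (‖gradient f x‖ ^ (2 * k) *
          ⟪gradient f x, hess f x (gradient f x)⟫))
        - Real.exp (-f x) * ‖gradient f x‖ ^ (2 * (k + 2)) := by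
  have hG : HasFDerivAt (gradient f) (hess f x) x :=
    ((aux_grad_contDiff f hf).differentiable one_ne_zero x).hasFDerivAt
  have hfx : HasFDerivAt f (fderiv ℝ f x) x :=
    (hf.differentiable two_ne_zero x).hasFDerivAt
  have hfg : ∀ v, fderiv ℝ f x v = ⟪gradient f x, v⟫ := by
    intro v; rw [← toDual_gradient (𝕜 := ℝ)]; simp
  have ha := (hG.norm_sq.pow (k + 1)).mul hfx.neg.exp
  have hV := ha.smul hG
  have hfun : (fun q => (‖gradient f q‖ ^ (2 * (k + 1)) * Real.exp (-f q)) • gradient f q)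
      = fun q => ((‖gradient f q‖ ^ 2) ^ (k + 1) * Real.exp (-f q)) • gradient f q := by
    funext q; rw [pow_mul]
  rw [hfun]
  erw [hV.fderiv, aux_trace]
  have hself : fderiv ℝ f x (gradient f x) = ‖gradient f x‖ ^ 2 := by
    rw [hfg, real_inner_self_eq_norm_sq]
  simp [hessTrace, hself]
  ring

theorem aux_gibbs (f : Ed d → ℝ) (μ : Measure (Ed d)) (Z : ℝ)
    (h : ∀ s : Set (Ed d), MeasurableSet s →
      μ s = ENNReal.ofReal Z⁻¹ * ∫⁻ x in s, ENNReal.ofReal (Real.exp (-f x))) :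
    μ = ENNReal.ofReal Z⁻¹ • volume.withDensity (fun x => ENNReal.ofReal (Real.exp (-f x))) := by
  ext s hs
  rw [h s hs, Measure.smul_apply, withDensity_apply _ hs, smul_eq_mul]

/-- integration-by-parts identity for gradient moments. -/
theorem grad_norm_integration_by_parts {d : ℕ} (f : Ed d → ℝ) (L : ℝ) (μ : Measure (Ed d))
    (ℓ : ℕ) (hℓ : 2 ≤ ℓ) (hf : ContDiff ℝ 2 f) (hL : LSmooth f L) (htail : SubexpTailed f)
    (hμ : IsGibbs f μ)
    (h₁ : Integrable (fun q => ‖gradient f q‖ ^ (2 * ℓ)) μ)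
    (h₂ : Integrable (fun q => ‖gradient f q‖ ^ (2 * (ℓ - 1)) * hessTrace f q) μ)
    (h₃ : Integrable (fun q => ‖gradient f q‖ ^ (2 * (ℓ - 2)) *
      (⟪gradient f q, hess f q (gradient f q)⟫ : ℝ)) μ) :
    ∫ q, ‖gradient f q‖ ^ (2 * ℓ) ∂μ
      = ∫ q, ‖gradient f q‖ ^ (2 * (ℓ - 1)) * hessTrace f q ∂μ
        + 2 * ((ℓ : ℝ) - 1) *
          ∫ q, ‖gradient f q‖ ^ (2 * (ℓ - 2)) *
            (⟪gradient f q, hess f q (gradient f q)⟫ : ℝ) ∂μ := by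
  obtain ⟨hp, Z, hZ, hm⟩ := hμ
  obtain ⟨k, rfl⟩ : ∃ k, ℓ = k + 2 := ⟨ℓ - 2, by omega⟩
  have e1 : k + 2 - 1 = k + 1 := by omega
  have e2 : k + 2 - 2 = k := by omega
  rw [e1] at h₂ ⊢
  rw [e2] at h₃ ⊢
  have hμeq := aux_gibbs f μ Z hm
  have hZ0 : ENNReal.ofReal Z⁻¹ ≠ 0 := by
    simpa using hZ
  have hmeas : Measurable (fun x => ENNReal.ofReal (Real.exp (-f x))) :=
    (Real.continuous_exp.comp hf.continuous.neg).measurable.ennreal_ofReal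
  have hlt : ∀ᵐ x ∂(volume : Measure (Ed d)), ENNReal.ofReal (Real.exp (-f x)) < ∞ :=
    Eventually.of_forall fun x => ENNReal.ofReal_lt_top
  have hI : ∀ g : Ed d → ℝ, Integrable g μ → Integrable (fun x => Real.exp (-f x) * g x) := by
    intro g hg
    rw [hμeq, integrable_smul_measure hZ0 ENNReal.ofReal_ne_top,
      integrable_withDensity_iff_integrable_smul' hmeas hlt] at hg
    simpa [ENNReal.toReal_ofReal (Real.exp_nonneg _)] using hg
  have hint : ∀ g : Ed d → ℝ, ∫ x, g x ∂μ = Z⁻¹ * ∫ x, Real.exp (-f x) * g x := by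
    intro g
    rw [hμeq, integral_smul_measure, integral_withDensity_eq_integral_toReal_smul hmeas hlt]
    simp [ENNReal.toReal_ofReal (Real.exp_nonneg _), ENNReal.toReal_ofReal (inv_nonneg.2 hZ.le)]
  have i1 := hI _ h₁
  have i2 := hI _ h₂
  have i3 := hI _ h₃
  have i0 : Integrable (fun x => Real.exp (-f x) * 1) := hI _ (integrable_const 1)
  have hGc := aux_grad_contDiff f hf
  have hVc : ContDiff ℝ 1 (fun q => (‖gradient f q‖ ^ (2 * (k + 1)) *
        Real.exp (-f q)) • gradient f q) := by
    have : ContDiff ℝ 1 (fun q => ((‖gradient f q‖ ^ 2) ^ (k + 1) *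
        Real.exp (-f q)) • gradient f q) :=
      (((hGc.norm_sq ℝ).pow _).mul (hf.of_le (by norm_num)).neg.exp).smul hGc
    simpa only [pow_mul] using this
  have hdf := aux_div_formula f hf k
  have hVi : Integrable (fun q => (‖gradient f q‖ ^ (2 * (k + 1)) *
        Real.exp (-f q)) • gradient f q) := by
    refine (i0.add i1).mono' hVc.continuous.aestronglyMeasurable
      (Eventually.of_forall fun x => ?_)
    have ht : 0 ≤ ‖gradient f x‖ := norm_nonneg _
    have he : 0 ≤ Real.exp (-f x) := Real.exp_nonneg _
    have hle : ‖gradient f x‖ ^ (2 * (k + 1) + 1) ≤ 1 + ‖gradient f x‖ ^ (2 * (k + 2)) := by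
      rcases le_total ‖gradient f x‖ 1 with h | h
      · have := pow_le_one₀ (n := 2 * (k + 1) + 1) ht h
        have : 0 ≤ ‖gradient f x‖ ^ (2 * (k + 2)) := by positivity
        linarith
      · have := pow_le_pow_right₀ h (show 2 * (k + 1) + 1 ≤ 2 * (k + 2) by omega)
        linarith
    rw [norm_smul, Real.norm_of_nonneg (by positivity)]
    calc _ = Real.exp (-f x) * ‖gradient f x‖ ^ (2 * (k + 1) + 1) := by ring
      _ ≤ Real.exp (-f x) * (1 + ‖gradient f x‖ ^ (2 * (k + 2))) := by gcongr
      _ = _ := by simp only [Pi.add_apply]; ring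
  have hz := aux_div_zero _ hVc hVi (by
    simp_rw [hdf]
    exact (i2.add (i3.const_mul _)).sub i1)
  simp_rw [hdf] at hz
  have i23 : Integrable (fun x => Real.exp (-f x) * (‖gradient f x‖ ^ (2 * (k + 1)) * hessTrace f x)
        + 2 * ((k : ℝ) + 1) * (Real.exp (-f x) * (‖gradient f x‖ ^ (2 * k) *
          ⟪gradient f x, hess f x (gradient f x)⟫))) := i2.add (i3.const_mul _)
  rw [integral_sub i23 i1, integral_add i2 (i3.const_mul _),
    integral_const_mul] at hz
  rw [hint, hint, hint]
  push_cast
  linear_combination (-Z⁻¹) * hz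

end
end

section
/- Let ℓ ≥ 2 be an integer and let H be a d × d symmetric positive semidefinite matrix. Then E_{p ∼ N(0, I_d)} (pᵀHp)^ℓ = E_{p ∼ N(0, I_d)}[(pᵀHp)^{ℓ−1}]·trace(H) + 2(ℓ−1)·E_{p ∼ N(0, I_d)}[(pᵀHp)^{ℓ−2}·pᵀH²p]. -/
open MeasureTheory Real Filter
open scoped ENNReal RealInnerProductSpace

noncomputable section

variable {d : ℕ}

/-- The (normalised) Gaussian weight. -/
def gw (d : ℕ) (p : Ed d) : ℝ := (2 * π) ^ (-(d : ℝ) / 2) * Real.exp (-‖p‖ ^ 2 / 2)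

lemma gw_nonneg (p : Ed d) : 0 ≤ gw d p := by unfold gw; positivity

lemma gw_continuous : Continuous (gw d) := by unfold gw; fun_prop

lemma integral_stdGaussian_eq (f : Ed d → ℝ) :
    ∫ p, f p ∂(stdGaussian d) = ∫ p, f p * gw d p := by
  have h : stdGaussian d = volume.withDensity fun p => ENNReal.ofReal (gw d p) := rfl
  rw [h, integral_withDensity_eq_integral_toReal_smul
    (gw_continuous.measurable.ennreal_ofReal) (by simp)]
  refine integral_congr_ae (ae_of_all _ fun p => ?_)
  simp [ENNReal.toReal_ofReal (gw_nonneg p), mul_comm]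

lemma integrable_temperate {f : Ed d → ℝ} (hf : f.HasTemperateGrowth) :
    Integrable (fun p => f p * gw d p) := by
  obtain ⟨k, C, hC⟩ := hf.2 0
  have hE : Integrable (fun p : Ed d => Real.exp (-(1/4) * ‖p‖ ^ 2)) := by
    have := (GaussianFourier.integrable_cexp_neg_mul_sq_norm_add (V := Ed d)
      (b := (1/4 : ℂ)) (by norm_num) 0 0).norm
    refine this.congr (ae_of_all _ fun p => ?_)
    simp [Complex.norm_exp, ← Complex.ofReal_pow]
  have hC0 : 0 ≤ C := by
    have := (norm_nonneg _).trans (hC 0)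
    simpa using this
  refine (hE.const_mul (C * k.factorial * Real.exp 2 * (2 * π) ^ (-(d : ℝ) / 2))).mono'
    ((hf.1.continuous.mul gw_continuous).aestronglyMeasurable) (ae_of_all _ fun p => ?_)
  have h1 : |f p| ≤ C * (1 + ‖p‖) ^ k := by simpa using hC p
  have h2 : (1 + ‖p‖) ^ k ≤ k.factorial * Real.exp (1 + ‖p‖) := by
    have := Real.pow_div_factorial_le_exp (x := 1 + ‖p‖) (by positivity) k
    rw [div_le_iff₀ (by positivity)] at this
    linarith
  have h3 : Real.exp (1 + ‖p‖) * Real.exp (-‖p‖ ^ 2 / 2)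
      ≤ Real.exp 2 * Real.exp (-(1/4) * ‖p‖ ^ 2) := by
    rw [← Real.exp_add, ← Real.exp_add]
    apply Real.exp_le_exp.2
    nlinarith [sq_nonneg (‖p‖ / 2 - 1)]
  rw [norm_mul, Real.norm_eq_abs, Real.norm_of_nonneg (gw_nonneg p), gw]
  have hc : (0:ℝ) ≤ (2 * π) ^ (-(d : ℝ) / 2) := by positivity
  generalize (2 * π) ^ (-(d : ℝ) / 2) = c at hc ⊢
  calc |f p| * (c * Real.exp (-‖p‖ ^ 2 / 2))
      ≤ (C * (k.factorial * Real.exp (1 + ‖p‖))) * (c * Real.exp (-‖p‖ ^ 2 / 2)) := by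
        gcongr
        exact h1.trans (by gcongr)
    _ = C * k.factorial * c * (Real.exp (1 + ‖p‖) * Real.exp (-‖p‖ ^ 2 / 2)) := by ring
    _ ≤ C * k.factorial * c * (Real.exp 2 * Real.exp (-(1/4) * ‖p‖ ^ 2)) := by gcongr
    _ = _ := by ring

lemma temperate_coord (i : Fin d) : (fun p : Ed d => p i).HasTemperateGrowth :=
  (EuclideanSpace.proj (𝕜 := ℝ) i : Ed d →L[ℝ] ℝ).hasTemperateGrowth

lemma gw_hasLineDerivAt (p : Ed d) (i : Fin d) :
    HasLineDerivAt ℝ (gw d) (-(p i * gw d p)) p (EuclideanSpace.single i 1) := by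
  have h : HasFDerivAt (fun p : Ed d => ‖p‖ ^ 2) (2 • innerSL ℝ p) p :=
    (hasStrictFDerivAt_norm_sq p).hasFDerivAt
  have h2 := ((((h.neg).mul_const (1/2 : ℝ)).exp).const_mul
    ((2 * π) ^ (-(d : ℝ) / 2))).hasLineDerivAt (EuclideanSpace.single i (1:ℝ))
  have e1 : gw d = fun y => (2 * π) ^ (-(d : ℝ) / 2) *
      rexp ((-fun p : Ed d => ‖p‖ ^ 2) y * (1 / 2)) := by
    funext q; simp [gw, div_eq_mul_inv]
  have e2 : -(p i * gw d p) = ((2 * π) ^ (-(d : ℝ) / 2) •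
      rexp ((-fun p : Ed d => ‖p‖ ^ 2) p * (1 / 2)) • (1 / 2 : ℝ) • -(2 • (innerSL ℝ) p))
      (EuclideanSpace.single i 1) := by
    simp [gw, EuclideanSpace.inner_single_right, div_eq_mul_inv]
    ring
  rw [e2, e1]
  exact h2

lemma stein {f f' : Ed d → ℝ} {i : Fin d} (hf : f.HasTemperateGrowth)
    (hf' : f'.HasTemperateGrowth)
    (h : ∀ p, HasLineDerivAt ℝ f (f' p) p (EuclideanSpace.single i 1)) :
    ∫ p, p i * f p * gw d p = ∫ p, f' p * gw d p := by
  have hif : (fun p : Ed d => p i * f p).HasTemperateGrowth := (temperate_coord i).mul hf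
  have hi := integrable_temperate hif
  have := integral_bilinear_hasLineDerivAt_right_eq_neg_left_of_integrable
    (μ := (volume : Measure (Ed d))) (f := f) (f' := f') (g := gw d)
    (g' := fun p => -(p i * gw d p)) (v := EuclideanSpace.single i 1)
    (B := ContinuousLinearMap.mul ℝ ℝ) (integrable_temperate hf')
    (hi.neg.congr (ae_of_all _ fun p => by simp; ring))
    (integrable_temperate hf) (fun p _ => h p) (fun p _ => gw_hasLineDerivAt p i)
  simp only [ContinuousLinearMap.mul_apply', mul_neg, integral_neg, neg_inj] at this
  rw [← this]
  congr 1; funext p; ring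

/-- Gaussian integration-by-parts identity for quadratic forms. -/
theorem gaussian_quadratic_form_identity {d : ℕ} (ℓ : ℕ) (hℓ : 2 ≤ ℓ)
    (H : Matrix (Fin d) (Fin d) ℝ) (hsymm : H.IsSymm) (hpsd : H.PosSemidef) :
    ∫ p, (∑ i, ∑ j, H i j * p i * p j) ^ ℓ ∂(stdGaussian d)
      = (∫ p, (∑ i, ∑ j, H i j * p i * p j) ^ (ℓ - 1) ∂(stdGaussian d)) * H.trace
        + 2 * ((ℓ : ℝ) - 1) *
          ∫ p, (∑ i, ∑ j, H i j * p i * p j) ^ (ℓ - 2) *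
            (∑ i, ∑ j, (H * H) i j * p i * p j) ∂(stdGaussian d) := by
  obtain ⟨n, rfl⟩ : ∃ n, ℓ = n + 2 := ⟨ℓ - 2, by omega⟩
  simp only [integral_stdGaussian_eq]
  let L : Fin d → (Ed d →L[ℝ] ℝ) := fun i =>
    ∑ j, H i j • (EuclideanSpace.proj (𝕜 := ℝ) j : Ed d →L[ℝ] ℝ)
  have hL : ∀ i p, L i p = ∑ j, H i j * p j := fun i p => by simp [L]
  have hH : ∀ i j, H i j = H j i := fun i j => hsymm.apply j i
  let Q : Ed d → ℝ := fun p => ∑ i, p i * L i p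
  have hQ : ∀ p : Ed d, ∑ i, ∑ j, H i j * p i * p j = Q p := fun p => by
    simp only [Q, hL, Finset.mul_sum]
    exact Finset.sum_congr rfl fun i _ => Finset.sum_congr rfl fun j _ => by ring
  have hHH : ∀ p : Ed d, ∑ i, ∑ j, (H * H) i j * p i * p j = ∑ k, L k p ^ 2 := fun p => by
    simp only [hL, sq, Matrix.mul_apply, Finset.sum_mul, Finset.mul_sum]
    calc _ = ∑ i, ∑ k, ∑ j, H i k * H k j * p i * p j :=
          Finset.sum_congr rfl fun i _ => Finset.sum_comm
      _ = ∑ k, ∑ i, ∑ j, H i k * H k j * p i * p j := Finset.sum_comm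
      _ = _ := Finset.sum_congr rfl fun k _ => by
          rw [Finset.sum_comm]
          exact Finset.sum_congr rfl fun i _ => Finset.sum_congr rfl fun j _ => by
            rw [hH j k]; ring
  have tL : ∀ i, (fun p => L i p).HasTemperateGrowth := fun i => (L i).hasTemperateGrowth
  have tQ : Q.HasTemperateGrowth :=
    Function.HasTemperateGrowth.sum fun i _ => (temperate_coord i).mul (tL i)
  have dQ : ∀ (i : Fin d) (p : Ed d),
      HasLineDerivAt ℝ Q (2 * L i p) p (EuclideanSpace.single i 1) := by
    intro i p
    have h1 : HasFDerivAt Q (∑ k, (p k • L k + L k p • (EuclideanSpace.proj (𝕜 := ℝ) k))) p :=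
      HasFDerivAt.fun_sum fun k _ =>
        ((EuclideanSpace.proj (𝕜 := ℝ) k : Ed d →L[ℝ] ℝ).hasFDerivAt).mul (L k).hasFDerivAt
    have h2 := h1.hasLineDerivAt (EuclideanSpace.single i 1)
    have e : (∑ k, (p k • L k + L k p • (EuclideanSpace.proj (𝕜 := ℝ) k)) : Ed d →L[ℝ] ℝ)
        (EuclideanSpace.single i 1) = 2 * L i p := by
      simp [hL, Finset.sum_add_distrib, Pi.single_apply]
      rw [two_mul]
      congr 1
      exact Finset.sum_congr rfl fun j _ => by rw [hH i j]; ring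
    rw [e] at h2
    exact h2
  have key : ∀ i, ∫ p, p i * (L i p * Q p ^ (n + 1)) * gw d p
      = ∫ p, (H i i * Q p ^ (n + 1) + 2 * (n + 1) * (Q p ^ n * L i p ^ 2)) * gw d p := by
    intro i
    refine stein ((tL i).mul (tQ.pow (n+1))) ?_ fun p => ?_
    · exact ((Function.HasTemperateGrowth.const (H i i)).mul (tQ.pow (n+1))).add
        ((Function.HasTemperateGrowth.const _).mul ((tQ.pow n).mul ((tL i).pow 2)))
    · have h1 : HasDerivAt (fun t : ℝ => L i (p + t • EuclideanSpace.single i 1)) (H i i) 0 := by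
        have := (L i).hasFDerivAt (x := p) |>.hasLineDerivAt (EuclideanSpace.single i 1)
        have e : L i (EuclideanSpace.single i 1) = H i i := by simp [hL, Pi.single_apply]
        rw [e] at this
        exact this
      have h2 : HasDerivAt (fun t : ℝ => Q (p + t • EuclideanSpace.single i 1))
        (2 * L i p) 0 := dQ i p
      have h3 := h1.mul (h2.pow (n+1))
      refine HasDerivAt.congr_deriv h3 ?_
      simp
      ring
  have tI : ∀ i, (fun p => p i * (L i p * Q p ^ (n + 1))).HasTemperateGrowth := fun i =>
    (temperate_coord i).mul ((tL i).mul (tQ.pow (n+1)))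
  have tA : (fun p => Q p ^ (n + 1)).HasTemperateGrowth := tQ.pow (n+1)
  have tB : ∀ i, (fun p => Q p ^ n * L i p ^ 2).HasTemperateGrowth := fun i =>
    (tQ.pow n).mul ((tL i).pow 2)
  have key2 : ∀ i, ∫ p, p i * (L i p * Q p ^ (n + 1)) * gw d p
      = H i i * (∫ p, Q p ^ (n + 1) * gw d p)
        + 2 * (n + 1) * ∫ p, Q p ^ n * L i p ^ 2 * gw d p := by
    intro i
    rw [key i, ← integral_const_mul, ← integral_const_mul, ← integral_add
      ((integrable_temperate tA).const_mul _) ((integrable_temperate (tB i)).const_mul _)]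
    congr 1; funext p; ring
  simp only [hQ, hHH]
  have e1 : ∫ p, Q p ^ (n + 2) * gw d p
      = ∑ i, ∫ p, p i * (L i p * Q p ^ (n + 1)) * gw d p := by
    rw [← integral_finsetSum _ fun i _ => integrable_temperate (tI i)]
    congr 1; funext p
    rw [← Finset.sum_mul, pow_succ' _ (n+1)]
    congr 1
    nth_rewrite 1 [show Q p = ∑ i, p i * L i p from rfl]
    rw [Finset.sum_mul]
    exact Finset.sum_congr rfl fun i _ => by ring
  have e2 : ∫ p, Q p ^ n * (∑ k, L k p ^ 2) * gw d p
      = ∑ i, ∫ p, Q p ^ n * L i p ^ 2 * gw d p := by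
    rw [← integral_finsetSum _ fun i _ => integrable_temperate (tB i)]
    congr 1; funext p
    rw [← Finset.sum_mul, ← Finset.mul_sum]
  rw [e1, show n + 2 - 1 = n + 1 from rfl, show n + 2 - 2 = n from rfl, e2]
  simp only [key2, Finset.sum_add_distrib, ← Finset.sum_mul, ← Finset.mul_sum, Matrix.trace,
    Matrix.diag_apply]
  push_cast
  ring

end
end

section
/- Let f : ℝ^d → ℝ be twice continuously differentiable and L-smooth, with μ ∝ e^{-f} subexponential-tailed and Υ := sup_x trace(∇²f(x)) < ∞. For any δ ∈ (0,1), suppose the step-size η > 0 satisfies η⁴ ≤ 1/(4096·max{L²·log(1/δ), L·Υ}), and let Λ ⊆ ℝ^d × ℝ^d be a measurable set with (μ × N(0,I_d))(Λ) ≥ 1 − δ on which the MALA acceptance probability satisfies 𝒜(q₀,p₀) ≥ e^{−1/4}. Define Ξ := {q₀ ∈ ℝ^d : P_{p₀ ∼ N(0,I_d)}((q₀,p₀) ∈ Λ) ≥ 15/16}. Then μ(Ξ) ≥ 1 − 16δ, and for every q₀ ∈ Ξ the MALA transition kernel T_{q₀} and proposal 𝒫_{q₀} satisfy d_TV(T_{q₀},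 𝒫_{q₀}) = 1 − E_{p₀ ∼ N(0,I_d)}[𝒜(q₀,p₀)] ≤ 1 − (15/16)·e^{−1/4} ≤ 1/3. -/
open MeasureTheory Real Filter
open scoped ENNReal RealInnerProductSpace

noncomputable section

variable {d : ℕ}

/-- Change of variables for the affine map defining the proposal. -/
theorem aux_map_gauss {d : ℕ} (m : Ed d) (η : ℝ) (hη : 0 < η) (s : Set (Ed d))
    (hs : MeasurableSet s) :
    gaussMeasure m (2 * (η ^ 2 / 2)) s = stdGaussian d ((fun p : Ed d => m + η • p) ⁻¹' s) := by
  have hg : Measurable (fun p : Ed d => m + η • p) := by fun_prop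
  have hmap : (volume : Measure (Ed d)).map (fun p : Ed d => m + η • p)
      = ENNReal.ofReal (|(η ^ d)⁻¹|) • (volume : Measure (Ed d)) := by
    have h1 : (fun p : Ed d => m + η • p) = (fun x => m + x) ∘ (fun p : Ed d => η • p) := rfl
    rw [h1, ← Measure.map_map (by fun_prop) (by fun_prop)]
    rw [Measure.map_addHaar_smul _ hη.ne', Measure.map_smul, map_add_left_eq_self]
    simp
  have hdm : Measurable (fun x : Ed d => ENNReal.ofReal
      ((2 * π * (2 * (η ^ 2 / 2))) ^ (-(d : ℝ) / 2) *
        Real.exp (-‖x - m‖ ^ 2 / (2 * (2 * (η ^ 2 / 2)))))) := by fun_prop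
  have key := setLIntegral_map (μ := (volume : Measure (Ed d))) hs hdm hg
  rw [hmap, Measure.restrict_smul, lintegral_smul_measure] at key
  unfold gaussMeasure stdGaussian
  rw [withDensity_apply _ hs, withDensity_apply _ (hg hs)]
  have hpos : 0 < η ^ d := by positivity
  have hpt : ∀ p : Ed d, ENNReal.ofReal
      ((2 * π * (2 * (η ^ 2 / 2))) ^ (-(d : ℝ) / 2) *
        Real.exp (-‖(m + η • p) - m‖ ^ 2 / (2 * (2 * (η ^ 2 / 2)))))
      = ENNReal.ofReal (|(η ^ d)⁻¹|) *
        ENNReal.ofReal ((2 * π) ^ (-(d : ℝ) / 2) * Real.exp (-‖p‖ ^ 2 / 2)) := by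
    intro p
    rw [← ENNReal.ofReal_mul (abs_nonneg _)]
    congr 1
    have e1 : -‖(m + η • p) - m‖ ^ 2 / (2 * (2 * (η ^ 2 / 2))) = -‖p‖ ^ 2 / 2 := by
      rw [add_sub_cancel_left, norm_smul, Real.norm_of_nonneg hη.le]
      field_simp
    have e2 : (2 * π * (2 * (η ^ 2 / 2))) ^ (-(d : ℝ) / 2)
        = (2 * π) ^ (-(d : ℝ) / 2) * (η ^ d)⁻¹ := by
      have : 2 * (η ^ 2 / 2) = η ^ 2 := by ring
      rw [this, Real.mul_rpow (by positivity) (by positivity)]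
      congr 1
      rw [← Real.rpow_natCast η 2, ← Real.rpow_mul hη.le, ← Real.rpow_natCast η d,
        ← Real.rpow_neg hη.le]
      congr 1
      push_cast
      ring
    rw [e1, e2, abs_of_pos (inv_pos.2 hpos)]
    ring
  simp_rw [hpt] at key
  rw [lintegral_const_mul _ (by fun_prop), smul_eq_mul] at key
  have hc0 : ENNReal.ofReal (|(η ^ d)⁻¹|) ≠ 0 := by
    simp only [ne_eq, ENNReal.ofReal_eq_zero, not_le]; positivity
  exact (ENNReal.mul_right_inj hc0 ENNReal.ofReal_ne_top).1 key

theorem aux_std_prob (d : ℕ) : IsProbabilityMeasure (stdGaussian d) := by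
  constructor
  unfold stdGaussian
  rw [withDensity_apply _ MeasurableSet.univ, Measure.restrict_univ]
  have hI : Integrable (fun v : Ed d => Real.exp (-(1/2) * ‖v‖ ^ 2)) := by
    by_contra h
    have h1 := GaussianFourier.integral_rexp_neg_mul_sq_norm (V := Ed d) (b := 1/2) (by norm_num)
    rw [integral_undef h] at h1
    have : 0 < (π / (1/2)) ^ ((Module.finrank ℝ (Ed d) : ℝ) / 2) := by positivity
    linarith
  have h1 := GaussianFourier.integral_rexp_neg_mul_sq_norm (V := Ed d) (b := 1/2) (by norm_num)
  have he : ∀ p : Ed d, (2 * π) ^ (-(d : ℝ) / 2) * Real.exp (-‖p‖ ^ 2 / 2)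
      = (2 * π) ^ (-(d : ℝ) / 2) * Real.exp (-(1/2) * ‖p‖ ^ 2) := by
    intro p; congr 2; ring
  simp_rw [he]
  rw [← ofReal_integral_eq_lintegral_ofReal (hI.const_mul _)
    (Eventually.of_forall fun p => by positivity), integral_const_mul, h1]
  have : π / (1/2) = 2 * π := by ring
  rw [this, finrank_euclideanSpace_fin, ← Real.rpow_add (by positivity)]
  have : -(d : ℝ) / 2 + d / 2 = 0 := by ring
  rw [this]; simp

theorem aux_leapQ {d : ℕ} (f : Ed d → ℝ) (η : ℝ) (q : Ed d) :
    (fun p => leapQ f η q p) = fun p => (q - (η ^ 2 / 2) • gradient f q) + η • p := by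
  funext p; unfold leapQ; abel

theorem aux_grad_cont {d : ℕ} (f : Ed d → ℝ) (hf : ContDiff ℝ 2 f) : Continuous (gradient f) := by
  unfold gradient
  exact (LinearIsometryEquiv.continuous _).comp (hf.continuous_fderiv (by norm_num))

theorem aux_accept_cont {d : ℕ} (f : Ed d → ℝ) (hf : ContDiff ℝ 2 f) (η : ℝ) (q : Ed d) :
    Continuous (fun p => accept f η q p) := by
  have hg := aux_grad_cont f hf
  have hc := hf.continuous
  have h0 : Continuous (fun p => leapQ f η q p) := by unfold leapQ; fun_prop
  have h1 : Continuous (fun p => leapP f η q p) := by unfold leapP; fun_prop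
  unfold accept
  refine continuous_const.min (Continuous.div (by fun_prop) (by fun_prop) fun p => ?_)
  exact (Real.exp_pos _).ne'

theorem aux_accept_nonneg {d : ℕ} (f : Ed d → ℝ) (η : ℝ) (q p : Ed d) : 0 ≤ accept f η q p := by
  unfold accept; positivity

theorem aux_accept_le {d : ℕ} (f : Ed d → ℝ) (η : ℝ) (q p : Ed d) : accept f η q p ≤ 1 :=
  min_le_left _ _

theorem aux_accept_int {d : ℕ} (f : Ed d → ℝ) (hf : ContDiff ℝ 2 f) (η : ℝ) (q : Ed d) :
    Integrable (fun p => accept f η q p) (stdGaussian d) := by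
  have := aux_std_prob d
  refine Integrable.of_bound (aux_accept_cont f hf η q).aestronglyMeasurable 1
    (Eventually.of_forall fun p => ?_)
  rw [Real.norm_of_nonneg (aux_accept_nonneg _ _ _ _)]
  exact aux_accept_le _ _ _ _

/-- The real measure of a set under the MALA kernel minus the proposal. -/
theorem aux_diff {d : ℕ} (f : Ed d → ℝ) (hf : ContDiff ℝ 2 f) (η : ℝ) (hη : 0 < η) (q : Ed d)
    (s : Set (Ed d)) (hs : MeasurableSet s) :
    (malaKernel f η q s).toReal -
      (gaussMeasure (q - (η ^ 2 / 2) • gradient f q) (2 * (η ^ 2 / 2)) s).toReal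
    = (1 - ∫ p₀, accept f η q p₀ ∂(stdGaussian d)) * s.indicator 1 q
      - ∫ p in (fun p => leapQ f η q p) ⁻¹' s, (1 - accept f η q p) ∂(stdGaussian d) := by
  have := aux_std_prob d
  have hI := aux_accept_int f hf η q
  have hm : Measurable (fun p => leapQ f η q p) := by
    rw [aux_leapQ]; fun_prop
  have hle : ∫ p₀, accept f η q p₀ ∂(stdGaussian d) ≤ 1 := by
    have := integral_mono hI (integrable_const (1:ℝ)) (fun p => aux_accept_le f η q p)
    simpa using this
  rw [aux_map_gauss _ _ hη _ hs, ← aux_leapQ]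
  have h2 : (∫⁻ p in (fun p => leapQ f η q p) ⁻¹' s, ENNReal.ofReal (accept f η q p)
      ∂(stdGaussian d)) = ENNReal.ofReal (∫ p in (fun p => leapQ f η q p) ⁻¹' s,
        accept f η q p ∂(stdGaussian d)) :=
    (ofReal_integral_eq_lintegral_ofReal hI.integrableOn
      (Eventually.of_forall fun p => aux_accept_nonneg f η q p)).symm
  have h1 : (malaKernel f η q s).toReal = (∫ p in (fun p => leapQ f η q p) ⁻¹' s,
        accept f η q p ∂(stdGaussian d)) +
      (1 - ∫ p₀, accept f η q p₀ ∂(stdGaussian d)) * s.indicator 1 q := by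
    unfold malaKernel
    rw [Measure.add_apply, Measure.map_apply hm hs, withDensity_apply _ (hm hs), h2,
      Measure.smul_apply, Measure.dirac_apply' _ hs, smul_eq_mul,
      ENNReal.toReal_add ENNReal.ofReal_ne_top, ENNReal.toReal_mul,
      ENNReal.toReal_ofReal (integral_nonneg fun p => aux_accept_nonneg f η q p),
      ENNReal.toReal_ofReal (by linarith)]
    · congr 2
      by_cases hq : q ∈ s <;> simp [hq]
    · refine ENNReal.mul_ne_top ENNReal.ofReal_ne_top ?_
      by_cases hq : q ∈ s <;> simp [hq]
  rw [h1, integral_sub (integrable_const _) hI.integrableOn]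
  simp [Measure.real]
  ring

theorem aux_singleton {d : ℕ} (hd : 0 < d) (f : Ed d → ℝ) (η : ℝ) (hη : 0 < η) (q : Ed d) :
    stdGaussian d ((fun p => leapQ f η q p) ⁻¹' {q}) = 0 := by
  have : Nonempty (Fin d) := ⟨⟨0, hd⟩⟩
  rw [aux_leapQ, ← aux_map_gauss _ _ hη _ (measurableSet_singleton q)]
  unfold gaussMeasure
  exact withDensity_absolutelyContinuous _ _ (measure_singleton q)

theorem aux_tv {d : ℕ} (f : Ed d → ℝ) (hf : ContDiff ℝ 2 f) (η : ℝ) (hη : 0 < η) (q : Ed d) :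
    tvDist (malaKernel f η q)
      (gaussMeasure (q - (η ^ 2 / 2) • gradient f q) (2 * (η ^ 2 / 2)))
      = 1 - ∫ p₀, accept f η q p₀ ∂(stdGaussian d) := by
  have := aux_std_prob d
  have hI := aux_accept_int f hf η q
  have hle : ∫ p₀, accept f η q p₀ ∂(stdGaussian d) ≤ 1 := by
    have := integral_mono hI (integrable_const (1:ℝ)) (fun p => aux_accept_le f η q p)
    simpa using this
  have hb : ∀ s : {s : Set (Ed d) // MeasurableSet s},
      |(malaKernel f η q s.1).toReal -
      (gaussMeasure (q - (η ^ 2 / 2) • gradient f q) (2 * (η ^ 2 / 2)) s.1).toReal|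
      ≤ 1 - ∫ p₀, accept f η q p₀ ∂(stdGaussian d) := by
    rintro ⟨s, hs⟩
    rw [aux_diff f hf η hη q s hs]
    have hnn : 0 ≤ ∫ p in (fun p => leapQ f η q p) ⁻¹' s, (1 - accept f η q p)
        ∂(stdGaussian d) :=
      integral_nonneg fun p => sub_nonneg.2 (aux_accept_le f η q p)
    have hup : ∫ p in (fun p => leapQ f η q p) ⁻¹' s, (1 - accept f η q p)
        ∂(stdGaussian d) ≤ 1 - ∫ p₀, accept f η q p₀ ∂(stdGaussian d) := by
      have h1 := setIntegral_le_integral (s := (fun p => leapQ f η q p) ⁻¹' s)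
        ((integrable_const (1:ℝ)).sub hI)
        (Eventually.of_forall fun p => sub_nonneg.2 (aux_accept_le f η q p))
      have h2 := integral_sub (integrable_const (1:ℝ)) hI
      simp only [Pi.sub_apply] at h1
      rw [h2] at h1
      simpa using h1
    rw [abs_le]
    by_cases hq : q ∈ s
    · simp only [hq, Set.indicator_of_mem, Pi.one_apply, mul_one]
      constructor <;> linarith
    · simp only [hq, not_false_eq_true, Set.indicator_of_notMem, mul_zero]
      constructor <;> linarith
  unfold tvDist
  have : Nonempty {s : Set (Ed d) // MeasurableSet s} := ⟨⟨∅, MeasurableSet.empty⟩⟩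
  refine le_antisymm (ciSup_le hb) ?_
  have hbd : BddAbove (Set.range fun s : {s : Set (Ed d) // MeasurableSet s} =>
      |(malaKernel f η q s.1).toReal -
      (gaussMeasure (q - (η ^ 2 / 2) • gradient f q) (2 * (η ^ 2 / 2)) s.1).toReal|) :=
    ⟨_, by rintro _ ⟨s, rfl⟩; exact hb s⟩
  rcases Nat.eq_zero_or_pos d with rfl | hd
  · have ha : ∀ p, accept f η q p = 1 := by
      intro p
      unfold accept
      rw [Subsingleton.elim (leapQ f η q p) q, Subsingleton.elim (leapP f η q p) p,
        div_self (Real.exp_pos _).ne', min_self]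
    have : 1 - ∫ p₀, accept f η q p₀ ∂(stdGaussian 0) = 0 := by simp [ha]
    rw [this]
    exact Real.iSup_nonneg fun s => abs_nonneg _
  · refine le_trans (le_of_eq ?_) (le_ciSup hbd ⟨{q}, measurableSet_singleton q⟩)
    simp only
    rw [aux_diff f hf η hη q _ (measurableSet_singleton q),
      setIntegral_measure_zero _ (aux_singleton hd f η hη q)]
    simp only [Set.mem_singleton_iff, Set.indicator_of_mem, Pi.one_apply, mul_one, sub_zero]
    rw [abs_of_nonneg (by linarith)]

theorem aux_markov {d : ℕ} (μ : Measure (Ed d)) [IsProbabilityMeasure μ] (δ : ℝ)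
    (Λ : Set (Ed d × Ed d)) (hΛm : MeasurableSet Λ)
    (hΛ : 1 - δ ≤ ((μ.prod (stdGaussian d)) Λ).toReal) :
    1 - 16 * δ ≤
      (μ {q₀ : Ed d | (15 : ℝ) / 16 ≤ ((stdGaussian d) {p₀ | (q₀, p₀) ∈ Λ}).toReal}).toReal := by
  have := aux_std_prob d
  have hmeas : Measurable fun q => ((stdGaussian d) {p₀ | (q, p₀) ∈ Λ}).toReal :=
    (measurable_measure_prodMk_left hΛm).ennreal_toReal
  have hint : Integrable (fun q => ((stdGaussian d) {p₀ | (q, p₀) ∈ Λ}).toReal) μ := by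
    refine Integrable.of_bound hmeas.aestronglyMeasurable 1 (Eventually.of_forall fun q => ?_)
    rw [Real.norm_of_nonneg ENNReal.toReal_nonneg]
    exact measureReal_le_one
  have heq : ((μ.prod (stdGaussian d)) Λ).toReal
      = ∫ q, ((stdGaussian d) {p₀ | (q, p₀) ∈ Λ}).toReal ∂μ := by
    rw [Measure.prod_apply hΛm]
    exact (integral_toReal (measurable_measure_prodMk_left hΛm).aemeasurable
      (Eventually.of_forall fun q => measure_lt_top _ _)).symm
  set Ξ := {q₀ : Ed d | (15 : ℝ) / 16 ≤ ((stdGaussian d) {p₀ | (q₀, p₀) ∈ Λ}).toReal} with hΞ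
  have hΞm : MeasurableSet Ξ := measurableSet_le measurable_const hmeas
  have hle : ∫ q, ((stdGaussian d) {p₀ | (q, p₀) ∈ Λ}).toReal ∂μ
      ≤ ∫ q, (15 / 16 + Ξ.indicator (fun _ => (1/16 : ℝ)) q) ∂μ := by
    refine integral_mono hint
      ((integrable_const _).add ((integrable_const _).indicator hΞm)) fun q => ?_
    by_cases hq : q ∈ Ξ
    · have : ((stdGaussian d) {p₀ | (q, p₀) ∈ Λ}).toReal ≤ 1 := measureReal_le_one
      simp only [hq, Set.indicator_of_mem]
      linarith
    · simp only [hq, not_false_eq_true, Set.indicator_of_notMem, add_zero]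
      exact (not_le.1 hq).le
  rw [integral_add (integrable_const _) ((integrable_const _).indicator hΞm),
    integral_indicator_const _ hΞm] at hle
  simp [Measure.real] at hle
  linarith

/-- from the high-acceptance set `Λ` to the good set `Ξ`. -/
theorem good_set_transition_overlap {d : ℕ} (f : Ed d → ℝ) (L Υ δ η : ℝ)
    (μ : Measure (Ed d))
    (hf : ContDiff ℝ 2 f) (hL : LSmooth f L) (htail : SubexpTailed f) (hμ : IsGibbs f μ)
    (hbdd : BddAbove (Set.range fun x : Ed d => hessTrace f x))
    (hΥ : Υ = ⨆ x : Ed d, hessTrace f x)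
    (hδ : δ ∈ Set.Ioo (0 : ℝ) 1) (hη : 0 < η)
    (hstep : η ^ 4 ≤ 1 / (4096 * max (L ^ 2 * Real.log (1 / δ)) (L * Υ)))
    (Λ : Set (Ed d × Ed d)) (hΛm : MeasurableSet Λ)
    (hΛ : 1 - δ ≤ ((μ.prod (stdGaussian d)) Λ).toReal)
    (hacc : ∀ qp ∈ Λ, Real.exp (-(1 / 4)) ≤ accept f η qp.1 qp.2) :
    ∀ Ξ : Set (Ed d),
      Ξ = {q₀ : Ed d | (15 : ℝ) / 16 ≤ ((stdGaussian d) {p₀ | (q₀, p₀) ∈ Λ}).toReal} →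
      1 - 16 * δ ≤ (μ Ξ).toReal ∧
      ∀ q₀ ∈ Ξ,
        tvDist (malaKernel f η q₀)
            (gaussMeasure (q₀ - (η ^ 2 / 2) • gradient f q₀) (2 * (η ^ 2 / 2)))
          = 1 - ∫ p₀, accept f η q₀ p₀ ∂(stdGaussian d) ∧
        1 - ∫ p₀, accept f η q₀ p₀ ∂(stdGaussian d)
          ≤ 1 - 15 / 16 * Real.exp (-(1 / 4)) ∧
        (1 - 15 / 16 * Real.exp (-(1 / 4)) : ℝ) ≤ 1 / 3 := by
  have := hμ.1
  have := aux_std_prob d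
  rintro Ξ rfl
  refine ⟨aux_markov μ δ Λ hΛm hΛ, fun q₀ hq => ⟨aux_tv f hf η hη q₀, ?_, ?_⟩⟩
  · have hI := aux_accept_int f hf η q₀
    have hq' : (15 : ℝ) / 16 ≤ ((stdGaussian d) {p₀ | (q₀, p₀) ∈ Λ}).toReal := hq
    have hm : MeasurableSet {p₀ | (q₀, p₀) ∈ Λ} := measurable_prodMk_left hΛm
    have h1 : ∫ p in {p₀ | (q₀, p₀) ∈ Λ}, accept f η q₀ p ∂(stdGaussian d)
        ≤ ∫ p, accept f η q₀ p ∂(stdGaussian d) :=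
      setIntegral_le_integral hI (Eventually.of_forall fun p => aux_accept_nonneg f η q₀ p)
    have h2 : ∫ p in {p₀ | (q₀, p₀) ∈ Λ}, Real.exp (-(1 / 4)) ∂(stdGaussian d)
        ≤ ∫ p in {p₀ | (q₀, p₀) ∈ Λ}, accept f η q₀ p ∂(stdGaussian d) :=
      setIntegral_mono_on (integrable_const _) hI.integrableOn hm fun p hp => hacc (q₀, p) hp
    rw [setIntegral_const, smul_eq_mul] at h2
    have h3 : 15 / 16 * Real.exp (-(1 / 4))
        ≤ (stdGaussian d).real {p₀ | (q₀, p₀) ∈ Λ} * Real.exp (-(1 / 4)) :=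
      mul_le_mul_of_nonneg_right hq' (Real.exp_pos _).le
    linarith
  · have := Real.add_one_le_exp (-(1 / 4) : ℝ)
    linarith

end
end
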